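/- Let k ≥ 4. If every minimum dicut of a k-extremal digraph D isolates a vertex, then D = ↔K_{k+1}. -/

import Mathlib

/-!
Common framework: finite digraphs on vertex set a `Finset ℕ`,
loopless and without parallel arcs (arcs are a `Finset (ℕ × ℕ)`).
-/

structure Dgraph where
  verts : Finset ℕ
  arcs : Finset (ℕ × ℕ)

namespace Dgraph

/-- Well-formedness: every arc joins two distinct vertices of the digraph
(no loops, arcs within the vertex set). -/
def WF (D : Dgraph) : Prop :=
  ∀ a ∈ D.arcs, a.1 ∈ D.verts ∧ a.2 ∈ D.verts ∧ a.1 ≠ a.2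

/-- `p` is a directed path from `u` to `v` in `D` (vertices pairwise distinct,
consecutive pairs are arcs). -/
def IsDipath (D : Dgraph) (p : List ℕ) (u v : ℕ) : Prop :=
  p.Nodup ∧ p.head? = some u ∧ p.getLast? = some v ∧
    (∀ x ∈ p, x ∈ D.verts) ∧ p.Chain' (fun a b => (a, b) ∈ D.arcs)

/-- The set of arcs used by a path (consecutive pairs). -/
def arcsOf (p : List ℕ) : Finset (ℕ × ℕ) := (p.zip p.tail).toFinset

/-- Local arc-connectivity `λ(u,v)`: the maximum number of pairwise
arc-disjoint directed paths from `u` to `v`. -/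
noncomputable def locLam (D : Dgraph) (u v : ℕ) : ℕ :=
  sSup {n | ∃ P : Fin n → List ℕ, (∀ i, D.IsDipath (P i) u v) ∧
    Pairwise fun i j => Disjoint (arcsOf (P i)) (arcsOf (P j))}

/-- Maximum local arc-connectivity `λ(D)`. -/
noncomputable def lam (D : Dgraph) : ℕ :=
  sSup {n | ∃ u ∈ D.verts, ∃ v ∈ D.verts, u ≠ v ∧ n = D.locLam u v}

/-- `p` is a directed cycle of `D` (cyclically consecutive pairs are arcs,
vertices pairwise distinct). -/
def IsDicycle (D : Dgraph) (p : List ℕ) : Prop :=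
  2 ≤ p.length ∧ p.Nodup ∧ (∀ x ∈ p, x ∈ D.verts) ∧
    p.Chain' (fun a b => (a, b) ∈ D.arcs) ∧
    ∀ x y, p.getLast? = some x → p.head? = some y → (x, y) ∈ D.arcs

/-- A colouring `φ` of the vertices with `k` colours is a `k`-dicolouring if
no directed cycle is monochromatic, i.e. every colour class induces an
acyclic subdigraph. -/
def IsDicolouring (D : Dgraph) (k : ℕ) (φ : ℕ → Fin k) : Prop :=
  ∀ p, D.IsDicycle p → ¬∃ c, ∀ x ∈ p, φ x = c

/-- The dichromatic number: least `k` admitting a `k`-dicolouring. -/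
noncomputable def dichi (D : Dgraph) : ℕ :=
  sInf {k | ∃ φ : ℕ → Fin k, D.IsDicolouring k φ}

/-- A monochromatic list of vertices. -/
def Mono {k : ℕ} (φ : ℕ → Fin k) (p : List ℕ) : Prop := ∃ c, ∀ x ∈ p, φ x = c

/-- `D` is strong: any vertex can reach any other by a directed path. -/
def Strong (D : Dgraph) : Prop :=
  ∀ u ∈ D.verts, ∀ v ∈ D.verts, u ≠ v → ∃ p, D.IsDipath p u v

/-- Induced subdigraph on `S`. -/
def induce (D : Dgraph) (S : Finset ℕ) : Dgraph where
  verts := D.verts ∩ S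
  arcs := D.arcs.filter fun a => a.1 ∈ S ∧ a.2 ∈ S

/-- Adjacency in the underlying undirected graph. -/
def adj (D : Dgraph) (x y : ℕ) : Prop := (x, y) ∈ D.arcs ∨ (y, x) ∈ D.arcs

/-- Reachability in the underlying undirected graph. -/
def UReach (D : Dgraph) (x y : ℕ) : Prop := Relation.ReflTransGen D.adj x y

/-- Connectivity of the underlying undirected graph. -/
def UConnected (D : Dgraph) : Prop :=
  D.verts.Nonempty ∧ ∀ u ∈ D.verts, ∀ v ∈ D.verts, D.UReach u v

/-- Deletion of a vertex. -/
def delVert (D : Dgraph) (v : ℕ) : Dgraph := D.induce (D.verts.erase v)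

/-- `v` is a cutvertex: its removal disconnects the underlying graph. -/
def IsCutvertex (D : Dgraph) (v : ℕ) : Prop :=
  v ∈ D.verts ∧ ¬(D.delVert v).UConnected

/-- Biconnected: the underlying graph is connected and has no cutvertex. -/
def Biconnected (D : Dgraph) : Prop :=
  D.UConnected ∧ ∀ v, ¬D.IsCutvertex v

/-- `D` is `k`-extremal: biconnected, strong and `χ⃗(D) = λ(D) + 1 = k + 1`. -/
def Extremal (k : ℕ) (D : Dgraph) : Prop :=
  D.Biconnected ∧ D.Strong ∧ D.dichi = k + 1 ∧ D.lam = k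

/-- The arcs of the dicut `(X, X̄)`: arcs from `X` to its complement. -/
def dicutArcs (D : Dgraph) (X : Finset ℕ) : Finset (ℕ × ℕ) :=
  D.arcs.filter fun a => a.1 ∈ X ∧ a.2 ∉ X

/-- `X` is the side of a dicut: `∅ ≠ X ⊊ V(D)`. -/
def IsDicutSide (D : Dgraph) (X : Finset ℕ) : Prop :=
  X ⊆ D.verts ∧ X.Nonempty ∧ X ≠ D.verts

/-- `(X, X̄)` is a minimum dicut of `D`. -/
def IsMinDicut (D : Dgraph) (X : Finset ℕ) : Prop :=
  D.IsDicutSide X ∧ ∀ Y, D.IsDicutSide Y → (D.dicutArcs X).card ≤ (D.dicutArcs Y).card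

def outdeg (D : Dgraph) (v : ℕ) : ℕ := (D.arcs.filter fun a => a.1 = v).card
def indeg (D : Dgraph) (v : ℕ) : ℕ := (D.arcs.filter fun a => a.2 = v).card

/-- Eulerian: every vertex has equal in- and out-degree. -/
def Eulerian (D : Dgraph) : Prop := ∀ v ∈ D.verts, D.outdeg v = D.indeg v

/-- Deleting a set of arcs. -/
def delArcs (D : Dgraph) (s : Finset (ℕ × ℕ)) : Dgraph := ⟨D.verts, D.arcs \ s⟩

/-- Adding an arc. -/
def addArc (D : Dgraph) (u v : ℕ) : Dgraph :=
  ⟨insert u (insert v D.verts), insert (u, v) D.arcs⟩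

/-- `D` is `m`-dicritical: `χ⃗(D) = m` and deleting any arc drops the
dichromatic number to at most `m - 1`. -/
def Dicritical (m : ℕ) (D : Dgraph) : Prop :=
  D.dichi = m ∧ ∀ a ∈ D.arcs, (D.delArcs {a}).dichi ≤ m - 1

/-- Renaming a vertex `x` to `y`. -/
def ren (x y z : ℕ) : ℕ := if z = x then y else z

def renArc (x y : ℕ) (a : ℕ × ℕ) : ℕ × ℕ := (ren x y a.1, ren x y a.2)

/-- Cyclically consecutive pairs of a list: the arcs of the directed cycle
through `p` in this cyclic order. -/
def cycArcs (p : List ℕ) : Finset (ℕ × ℕ) := (p.zip (p.rotate 1)).toFinset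

/-- `D` is a directed cycle. -/
def IsDirectedCycleGraph (D : Dgraph) : Prop :=
  ∃ p : List ℕ, 2 ≤ p.length ∧ p.Nodup ∧ D.verts = p.toFinset ∧ D.arcs = cycArcs p

/-- `D` is the bidirected complete digraph `↔K_n`. -/
def IsBiComplete (D : Dgraph) (n : ℕ) : Prop :=
  D.verts.card = n ∧ D.arcs = (D.verts ×ˢ D.verts).filter fun a => a.1 ≠ a.2

/-- Arcs of a bidirected (symmetric) cycle through `p`. -/
def symmCyc (p : List ℕ) : Finset (ℕ × ℕ) := cycArcs p ∪ (cycArcs p).image Prod.swap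

/-- `D` is a symmetric odd wheel: a bidirected odd cycle (≥ 3 vertices)
plus a hub joined by digons to all cycle vertices. -/
def IsSymOddWheel (D : Dgraph) : Prop :=
  ∃ (p : List ℕ) (x : ℕ), 3 ≤ p.length ∧ Odd p.length ∧ p.Nodup ∧ x ∉ p ∧
    D.verts = insert x p.toFinset ∧
    D.arcs = symmCyc p ∪ p.toFinset.image (fun y => (x, y)) ∪
      p.toFinset.image (fun y => (y, x))

/-- A fresh vertex not in `D`. -/
def fresh (D : Dgraph) : ℕ := (D.verts.sup id) + 1

/-- Contraction `D/X`: `X` is contracted into a single new vertex; arcs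
inside `X` are deleted and parallel arcs created by contraction are
identified. -/
def contract (D : Dgraph) (X : Finset ℕ) : Dgraph where
  verts := insert (fresh D) (D.verts \ X)
  arcs := (D.arcs.image fun a =>
      (if a.1 ∈ X then fresh D else a.1, if a.2 ∈ X then fresh D else a.2)).filter
      fun a => a.1 ≠ a.2

/-- `D` is the directed Hajós join of `D1` and `D2` with respect to the arcs
`(u,v1) ∈ A(D1)` and `(v2,w) ∈ A(D2)`, the vertices `v1, v2` being
identified into the new vertex `v`, and the arc `(u,w)` being added. -/
def IsDirHajosJoinAt (D D1 D2 : Dgraph) (u v1 v2 w v : ℕ) : Prop :=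
  D1.WF ∧ D2.WF ∧ Disjoint D1.verts D2.verts ∧
  (u, v1) ∈ D1.arcs ∧ (v2, w) ∈ D2.arcs ∧
  v ∉ (D1.verts.erase v1) ∪ (D2.verts.erase v2) ∧
  D.verts = insert v ((D1.verts.erase v1) ∪ (D2.verts.erase v2)) ∧
  D.arcs = insert (u, w)
    (((D1.arcs.erase (u, v1)) ∪ (D2.arcs.erase (v2, w))).image
      fun a => renArc v2 v (renArc v1 v a))

def IsDirHajosJoin (D D1 D2 : Dgraph) : Prop :=
  ∃ u v1 v2 w v, IsDirHajosJoinAt D D1 D2 u v1 v2 w v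

/-- Bidirected Hajós join with respect to the digons `[u,v1] ⊆ A(D1)` and
`[w,v2] ⊆ A(D2)`. -/
def IsBidirHajosJoinAt (D D1 D2 : Dgraph) (u v1 v2 w v : ℕ) : Prop :=
  D1.WF ∧ D2.WF ∧ Disjoint D1.verts D2.verts ∧
  (u, v1) ∈ D1.arcs ∧ (v1, u) ∈ D1.arcs ∧ (w, v2) ∈ D2.arcs ∧ (v2, w) ∈ D2.arcs ∧
  v ∉ (D1.verts.erase v1) ∪ (D2.verts.erase v2) ∧
  D.verts = insert v ((D1.verts.erase v1) ∪ (D2.verts.erase v2)) ∧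
  D.arcs = insert (u, w) (insert (w, u)
    (((D1.arcs \ {(u, v1), (v1, u)}) ∪ (D2.arcs \ {(w, v2), (v2, w)})).image
      fun a => renArc v2 v (renArc v1 v a)))

def IsBidirHajosJoin (D D1 D2 : Dgraph) : Prop :=
  ∃ u v1 v2 w v, IsBidirHajosJoinAt D D1 D2 u v1 v2 w v

/-- Hajós bijoin of `D1` and `D2` with respect to `((t,a1,w),(v,a2,u))`:
`ta1, a1w ∈ A(D1)` with `t,w` in the same connected component of `D1 ∖ a1`,
`va2, a2u ∈ A(D2)` with `u,v` in the same connected component of `D2 ∖ a2`;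
`a1` and `a2` are identified into the new vertex `a` and the arcs
`tu` and `vw` are added. -/
def IsHajosBijoinAt (D D1 D2 : Dgraph) (t a1 w v a2 u a : ℕ) : Prop :=
  D1.WF ∧ D2.WF ∧ Disjoint D1.verts D2.verts ∧
  (t, a1) ∈ D1.arcs ∧ (a1, w) ∈ D1.arcs ∧
  (v, a2) ∈ D2.arcs ∧ (a2, u) ∈ D2.arcs ∧
  (D1.delVert a1).UReach t w ∧
  (D2.delVert a2).UReach u v ∧
  a ∉ (D1.verts.erase a1) ∪ (D2.verts.erase a2) ∧
  D.verts = insert a ((D1.verts.erase a1) ∪ (D2.verts.erase a2)) ∧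
  D.arcs = insert (t, u) (insert (v, w)
    (((D1.arcs \ {(t, a1), (a1, w)}) ∪ (D2.arcs \ {(v, a2), (a2, u)})).image
      fun x => renArc a2 a (renArc a1 a x)))

def IsHajosBijoin (D D1 D2 : Dgraph) : Prop :=
  ∃ t a1 w v a2 u a, IsHajosBijoinAt D D1 D2 t a1 w v a2 u a

/-! ### Trees, Euler tours and Hajós tree joins -/

/-- Vertex set of the tree given by edges `e : Fin n → ℕ × ℕ`. -/
def treeVerts (n : ℕ) (e : Fin n → ℕ × ℕ) : Finset ℕ :=
  Finset.univ.image (fun i => (e i).1) ∪ Finset.univ.image (fun i => (e i).2)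

/-- The bidirected digraph `↔T` of the tree. -/
def treeDigraph (n : ℕ) (e : Fin n → ℕ × ℕ) : Dgraph where
  verts := treeVerts n e
  arcs := Finset.univ.image (fun i : Fin n => e i) ∪
    Finset.univ.image (fun i : Fin n => (e i).swap)

/-- `e` lists the edges of a tree: loopless, pairwise distinct edges,
connected, with `n + 1` vertices for `n` edges. -/
def IsTree (n : ℕ) (e : Fin n → ℕ × ℕ) : Prop :=
  (∀ i, (e i).1 ≠ (e i).2) ∧
  (∀ i j, i ≠ j → e i ≠ e j ∧ e i ≠ (e j).swap) ∧
  (treeDigraph n e).UConnected ∧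
  (treeVerts n e).card = n + 1

/-- The leaves of the tree: vertices incident to exactly one edge. -/
def leafSet (n : ℕ) (e : Fin n → ℕ × ℕ) : Finset ℕ :=
  (treeVerts n e).filter fun x =>
    (Finset.univ.filter fun i : Fin n => (e i).1 = x ∨ (e i).2 = x).card = 1

/-- `L` is an Eulerian list of the tree: the cyclic sequence of consecutive
pairs of `L` traverses each arc of `↔T` exactly once. -/
def IsEulerTour (n : ℕ) (e : Fin n → ℕ × ℕ) (L : List ℕ) : Prop :=
  ((L.zip (L.rotate 1) : List (ℕ × ℕ)) : Multiset (ℕ × ℕ)) = (treeDigraph n e).arcs.val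

/-- `C` is a partial Eulerian list: a circular sublist of an Eulerian list
containing every leaf, in which every non-leaf vertex appears at most once. -/
def IsPartialEulerList (n : ℕ) (e : Fin n → ℕ × ℕ) (C : List ℕ) : Prop :=
  ∃ L m, IsEulerTour n e L ∧ List.Sublist C (L.rotate m) ∧
    (∀ x ∈ leafSet n e, x ∈ C) ∧
    ∀ x ∈ C, x ∉ leafSet n e → C.count x ≤ 1

/-- Compatibility of the data of a (extended) Hajós tree join:
a tree with edges `uᵢvᵢ = e i`, digraphs `Ds i` with
`V(Ds i) ∩ V(T) = {uᵢ, vᵢ}`, `[uᵢ,vᵢ] ⊆ A(Ds i)` and whose remaining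
vertex sets are pairwise disjoint. -/
def JoinCompat (n : ℕ) (e : Fin n → ℕ × ℕ) (Ds : Fin n → Dgraph) : Prop :=
  IsTree n e ∧ (∀ i, (Ds i).WF) ∧
  (∀ i, (Ds i).verts ∩ treeVerts n e = {(e i).1, (e i).2}) ∧
  (∀ i, e i ∈ (Ds i).arcs ∧ (e i).swap ∈ (Ds i).arcs) ∧
  (∀ i j, i ≠ j →
    Disjoint ((Ds i).verts \ {(e i).1, (e i).2}) ((Ds j).verts \ {(e j).1, (e j).2}))

/-- The digraph obtained from the digraphs `Ds i − [uᵢ,vᵢ]` by adding the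
directed cycle through the list `C`. -/
def joinOf (n : ℕ) (e : Fin n → ℕ × ℕ) (Ds : Fin n → Dgraph) (C : List ℕ) : Dgraph where
  verts := Finset.univ.biUnion fun i => (Ds i).verts
  arcs := (Finset.univ.biUnion fun i => (Ds i).arcs \ {e i, (e i).swap}) ∪ cycArcs C

/-- `D` is the Hajós tree join `T(D₁, …, Dₙ; C)`: the peripheral cycle runs
through the leaves of `T` in the circular order given by a plane embedding
of `T` (equivalently, the order of the leaves along an Euler tour of `↔T`). -/
def IsHajosTreeJoin (D : Dgraph) (n : ℕ) (e : Fin n → ℕ × ℕ)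
    (Ds : Fin n → Dgraph) : Prop :=
  JoinCompat n e Ds ∧ ∃ L, IsEulerTour n e L ∧
    D = joinOf n e Ds (L.filter fun x => decide (x ∈ leafSet n e))

/-- `D` is an extended Hajós tree join: the peripheral cycle runs through a
partial Eulerian list of `T`. -/
def IsExtHajosTreeJoin (D : Dgraph) (n : ℕ) (e : Fin n → ℕ × ℕ)
    (Ds : Fin n → Dgraph) : Prop :=
  JoinCompat n e Ds ∧ ∃ C, IsPartialEulerList n e C ∧ D = joinOf n e Ds C

/-- Hajós star join: a Hajós tree join whose tree is a star. -/
def IsHajosStarJoin (D : Dgraph) (n : ℕ) (e : Fin n → ℕ × ℕ)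
    (Ds : Fin n → Dgraph) : Prop :=
  IsHajosTreeJoin D n e Ds ∧ ∃ c, ∀ i, (e i).1 = c ∨ (e i).2 = c

/-- The class `H⃗_k`: for `k = 3` the smallest class containing the symmetric
odd wheels and closed under directed Hajós joins and Hajós tree joins; for
`k ≥ 4` the smallest class containing `↔K_{k+1}` and closed under directed
Hajós joins and Hajós tree joins. -/
inductive HClass (k : ℕ) : Dgraph → Prop
  | wheel (D : Dgraph) (hk : k = 3) (h : IsSymOddWheel D) : HClass k D
  | complete (D : Dgraph) (hk : 4 ≤ k) (h : IsBiComplete D (k + 1)) : HClass k D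
  | dirJoin (D D1 D2 : Dgraph) (h1 : HClass k D1) (h2 : HClass k D2)
      (h : IsDirHajosJoin D D1 D2) : HClass k D
  | treeJoin (D : Dgraph) (n : ℕ) (e : Fin n → ℕ × ℕ) (Ds : Fin n → Dgraph)
      (h : ∀ i, HClass k (Ds i)) (hj : IsHajosTreeJoin D n e Ds) : HClass k D

/-- The class `EH⃗T_k`: for `k = 3` the smallest class containing the
symmetric odd wheels and closed under extended Hajós tree joins; for `k ≥ 4`
the smallest class containing `↔K_{k+1}` and closed under extended Hajós
tree joins. -/
inductive EHTClass (k : ℕ) : Dgraph → Prop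
  | wheel (D : Dgraph) (hk : k = 3) (h : IsSymOddWheel D) : EHTClass k D
  | complete (D : Dgraph) (hk : 4 ≤ k) (h : IsBiComplete D (k + 1)) : EHTClass k D
  | extJoin (D : Dgraph) (n : ℕ) (e : Fin n → ℕ × ℕ) (Ds : Fin n → Dgraph)
      (h : ∀ i, EHTClass k (Ds i)) (hj : IsExtHajosTreeJoin D n e Ds) : EHTClass k D

/-- Parallel Hajós join of `D_AC` and `D_B` with respect to
`(t, u, v, w, [a,b])`. -/
def IsParallelHajosJoinAt (D DAC DB : Dgraph) (A C : Finset ℕ)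
    (x t u v w a b : ℕ) : Prop :=
  DAC.WF ∧ DB.WF ∧
  (a, b) ∈ DB.arcs ∧ (b, a) ∈ DB.arcs ∧
  DAC.verts = A ∪ C ∧ A ∩ C = {x} ∧
  t ∈ A.erase x ∧ w ∈ A.erase x ∧ u ∈ C.erase x ∧ v ∈ C.erase x ∧
  (t, u) ∈ DAC.arcs ∧ (v, w) ∈ DAC.arcs ∧
  (DAC.delVert x).UReach t w ∧
  ((DAC.induce C).delVert x).UReach u v ∧
  Disjoint DAC.verts DB.verts ∧
  D.verts = DB.verts ∪ (A.erase x) ∪ (C.erase x) ∧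
  D.arcs = insert (t, u) (insert (v, w)
    ((DB.arcs \ {(a, b), (b, a)}) ∪
      ((DAC.induce A).arcs.image (renArc x a)) ∪
      ((DAC.induce C).arcs.image (renArc x b))))

def IsParallelHajosJoin (D DAC DB : Dgraph) : Prop :=
  ∃ A C x t u v w a b, IsParallelHajosJoinAt D DAC DB A C x t u v w a b

/-- `S` is (the vertex set of) a strong component of `D`. -/
def IsStrongComponent (D : Dgraph) (S : Finset ℕ) : Prop :=
  S ⊆ D.verts ∧ S.Nonempty ∧ (D.induce S).Strong ∧
  ∀ S', S ⊆ S' → S' ⊆ D.verts → (D.induce S').Strong → S' = S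

/-- `B` is (the vertex set of) a block of `D`: a maximal set inducing a
biconnected subdigraph. -/
def IsBlock (D : Dgraph) (B : Finset ℕ) : Prop :=
  B ⊆ D.verts ∧ (D.induce B).Biconnected ∧
  ∀ B', B ⊆ B' → B' ⊆ D.verts → (D.induce B').Biconnected → B' = B

end Dgraph

open Dgraph

open Dgraph

open Classical in
theorem exists_nodup_path {α : Type*} {r : α → α → Prop} {a b : α}
    (h : Relation.ReflTransGen r a b) :
    ∃ t : List α, (a :: t).Nodup ∧ (a :: t).IsChain r ∧ (a :: t).getLast? = some b := by
  induction h using Relation.ReflTransGen.head_induction_on with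
  | refl => exact ⟨[], by simp, by simp, by simp⟩
  | @head a c hac _ ih =>
    obtain ⟨t, hn, hc, hl⟩ := ih
    by_cases ha : a ∈ c :: t
    · obtain ⟨s, t', hst⟩ := List.append_of_mem ha
      rw [hst] at hn hc hl
      refine ⟨t', (List.nodup_append.1 hn).2.1, (List.isChain_append.1 hc).2.1, ?_⟩
      rw [List.getLast?_append] at hl
      simpa using hl
    · refine ⟨c :: t, List.nodup_cons.2 ⟨ha, hn⟩, List.isChain_cons_cons.2 ⟨hac, hc⟩, ?_⟩
      rw [List.getLast?_cons_cons]; exact hl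

namespace DgAux

def net (F : Finset (ℕ × ℕ)) (w : ℕ) : ℤ :=
  ∑ a ∈ F, ((if a.1 = w then 1 else 0) - (if a.2 = w then 1 else 0))

def dl (u w : ℕ) : ℤ := if u = w then 1 else 0

theorem net_insert {F : Finset (ℕ × ℕ)} {a b : ℕ} (h : (a, b) ∉ F) (w : ℕ) :
    net (insert (a, b) F) w = net F w + dl a w - dl b w := by
  unfold net dl
  rw [Finset.sum_insert h]; ring

theorem net_erase {F : Finset (ℕ × ℕ)} {a b : ℕ} (h : (a, b) ∈ F) (w : ℕ) :
    net (F.erase (a, b)) w = net F w - dl a w + dl b w := by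
  have := net_insert (Finset.notMem_erase (a, b) F) w
  rw [Finset.insert_erase h] at this
  rw [this]; ring

theorem net_cut (F : Finset (ℕ × ℕ)) (X : Finset ℕ) :
    ∑ w ∈ X, net F w = ((F.filter fun a => a.1 ∈ X ∧ a.2 ∉ X).card : ℤ)
      - ((F.filter fun a => a.1 ∉ X ∧ a.2 ∈ X).card : ℤ) := by
  unfold net
  rw [Finset.sum_comm, Finset.card_filter, Finset.card_filter]
  push_cast
  rw [← Finset.sum_sub_distrib]
  refine Finset.sum_congr rfl fun a _ => ?_
  rw [Finset.sum_sub_distrib, Finset.sum_ite_eq, Finset.sum_ite_eq]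
  by_cases h1 : a.1 ∈ X <;> by_cases h2 : a.2 ∈ X <;> simp [h1, h2]

theorem sum_dl (X : Finset ℕ) (u : ℕ) : ∑ w ∈ X, dl u w = if u ∈ X then 1 else 0 := by
  unfold dl; rw [Finset.sum_ite_eq]

/-- Augmenting along a path of the residual graph. -/
theorem augment (A : Finset (ℕ × ℕ)) (v : ℕ) : ∀ (t : List ℕ) (a : ℕ) (F : Finset (ℕ × ℕ)),
    F ⊆ A → (a :: t).Nodup →
    (a :: t).IsChain (fun x y => ((x, y) ∈ A ∧ (x, y) ∉ F) ∨ (y, x) ∈ F) →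
    (a :: t).getLast? = some v →
    ∃ F' ⊆ A, ∀ w, net F' w = net F w + dl a w - dl v w := by
  intro t
  induction t with
  | nil =>
    intro a F hF _ _ hl
    simp at hl
    subst hl
    exact ⟨F, hF, fun w => by ring⟩
  | cons b t ih =>
    intro a F hF hn hc hl
    rw [List.getLast?_cons_cons] at hl
    rw [List.isChain_cons_cons] at hc
    obtain ⟨hab, hc⟩ := hc
    have hn' := List.nodup_cons.1 hn
    have key : ∀ F1 : Finset (ℕ × ℕ), (∀ x y, x ≠ a → y ≠ a → ((x, y) ∈ F1 ↔ (x, y) ∈ F)) →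
        (b :: t).IsChain (fun x y => ((x, y) ∈ A ∧ (x, y) ∉ F1) ∨ (y, x) ∈ F1) := by
      intro F1 h1
      refine List.IsChain.imp_of_mem_imp ?_ hc
      intro x y hx hy hxy
      have hxa : x ≠ a := fun h => hn'.1 (h ▸ hx)
      have hya : y ≠ a := fun h => hn'.1 (h ▸ hy)
      rwa [h1 x y hxa hya, h1 y x hya hxa]
    rcases hab with ⟨h1, h2⟩ | h1
    · obtain ⟨F', hF', h⟩ := ih b (insert (a, b) F)
        (Finset.insert_subset h1 hF) hn'.2 (key _ (by
          intro x y hx hy; simp [hx])) hl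
      refine ⟨F', hF', fun w => ?_⟩
      rw [h w, net_insert h2]; ring
    · obtain ⟨F', hF', h⟩ := ih b (F.erase (b, a))
        ((Finset.erase_subset _ _).trans hF) hn'.2 (key _ (by
          intro x y hx hy; simp [hy])) hl
      refine ⟨F', hF', fun w => ?_⟩
      rw [h w, net_erase h1]; ring

theorem arcsOf_cons_cons (a b : ℕ) (t : List ℕ) :
    Dgraph.arcsOf (a :: b :: t) = insert (a, b) (Dgraph.arcsOf (b :: t)) := by
  simp [Dgraph.arcsOf]

theorem mem_of_arcsOf {p : List ℕ} {x y : ℕ} (h : (x, y) ∈ Dgraph.arcsOf p) :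
    x ∈ p ∧ y ∈ p := by
  simp only [Dgraph.arcsOf, List.mem_toFinset] at h
  have := List.of_mem_zip h
  exact ⟨this.1, List.mem_of_mem_tail this.2⟩

theorem arcsOf_chain {r : ℕ → ℕ → Prop} : ∀ (t : List ℕ) (a : ℕ), (a :: t).IsChain r →
    ∀ x y, (x, y) ∈ Dgraph.arcsOf (a :: t) → r x y := by
  intro t
  induction t with
  | nil => intro a _ x y h; simp [Dgraph.arcsOf] at h
  | cons b t ih =>
    intro a hc x y h
    rw [List.isChain_cons_cons] at hc
    rw [arcsOf_cons_cons, Finset.mem_insert] at h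
    rcases h with h | h
    · cases h; exact hc.1
    · exact ih b hc.2 x y h

/-- net of a path. -/
theorem net_path (v : ℕ) : ∀ (t : List ℕ) (a : ℕ), (a :: t).Nodup →
    (a :: t).getLast? = some v → ∀ w, net (Dgraph.arcsOf (a :: t)) w = dl a w - dl v w := by
  intro t
  induction t with
  | nil => intro a _ h w; simp at h; subst h; simp [Dgraph.arcsOf, net]
  | cons b t ih =>
    intro a hn hl w
    rw [List.getLast?_cons_cons] at hl
    have hn' := List.nodup_cons.1 hn
    rw [arcsOf_cons_cons, net_insert, ih b hn'.2 hl w]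
    · ring
    · intro h; exact hn'.1 (mem_of_arcsOf h).1

theorem net_sdiff {F G : Finset (ℕ × ℕ)} (h : G ⊆ F) (w : ℕ) :
    net (F \ G) w = net F w - net G w := by
  unfold net
  rw [eq_sub_iff_add_eq, Finset.sum_sdiff h]

open Classical in
/-- Set of vertices (in `V`) reachable from `u`. -/
theorem flow_decomp (V : Finset ℕ) (A : Finset (ℕ × ℕ))
    (hA : ∀ a ∈ A, a.1 ∈ V ∧ a.2 ∈ V) (u v : ℕ) (hu : u ∈ V) :
    ∀ (m : ℕ) (F : Finset (ℕ × ℕ)), F ⊆ A → (∀ w, net F w = m * dl u w - m * dl v w) →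
    ∃ P : Fin m → List ℕ, (∀ i, (P i).Nodup ∧ (P i).head? = some u ∧ (P i).getLast? = some v ∧
      (P i).IsChain (fun x y => (x, y) ∈ F)) ∧
      Pairwise fun i j => Disjoint (Dgraph.arcsOf (P i)) (Dgraph.arcsOf (P j)) := by
  intro m
  induction m with
  | zero => intro F _ _; exact ⟨fun i => i.elim0, fun i => i.elim0, fun (i : Fin 0) => i.elim0⟩
  | succ m ih =>
    intro F hF hnet
    have hreach : Relation.ReflTransGen (fun x y => (x, y) ∈ F) u v := by
      by_contra hcon
      set X := V.filter fun x => Relation.ReflTransGen (fun x y => (x, y) ∈ F) u x with hX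
      have h1 := net_cut F X
      have huX : u ∈ X := by simp [hX, hu]; exact Relation.ReflTransGen.refl
      have hvX : v ∉ X := by simp [hX, hcon]
      have h2 : (F.filter fun a => a.1 ∈ X ∧ a.2 ∉ X) = ∅ := by
        rw [Finset.filter_eq_empty_iff]
        rintro ⟨x, y⟩ hxy ⟨hx, hy⟩
        apply hy
        simp only [hX, Finset.mem_filter] at hx ⊢
        exact ⟨(hA _ (hF hxy)).2, hx.2.tail hxy⟩
      rw [h2, Finset.sum_congr rfl (fun w _ => hnet w), Finset.sum_sub_distrib,
        ← Finset.mul_sum, ← Finset.mul_sum, sum_dl, sum_dl, if_pos huX, if_neg hvX] at h1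
      push_cast at h1
      simp at h1
      omega
    obtain ⟨t, hn, hc, hl⟩ := exists_nodup_path hreach
    have hsub : Dgraph.arcsOf (u :: t) ⊆ F := by
      rintro ⟨x, y⟩ h
      exact arcsOf_chain t u hc x y h
    obtain ⟨P, hP, hd⟩ := ih (F \ Dgraph.arcsOf (u :: t)) (Finset.sdiff_subset.trans hF) (by
      intro w
      rw [net_sdiff hsub, net_path v t u hn hl, hnet w]; push_cast; ring)
    have hdis : ∀ i, Disjoint (Dgraph.arcsOf (u :: t)) (Dgraph.arcsOf (P i)) := by
      intro i
      rw [Finset.disjoint_left]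
      rintro ⟨x, y⟩ h1 h2
      obtain ⟨_, hh, _, hci⟩ := hP i
      cases hp : P i with
      | nil => rw [hp] at hh; simp at hh
      | cons a s =>
        rw [hp] at hci h2
        have := arcsOf_chain s a hci x y h2
        exact (Finset.mem_sdiff.1 this).2 h1
    refine ⟨Fin.cons (u :: t) P, ?_, ?_⟩
    · intro i
      refine Fin.cases ?_ ?_ i
      · exact ⟨hn, by simp, hl, hc⟩
      · intro i
        obtain ⟨h1, h2, h3, h4⟩ := hP i
        refine ⟨h1, h2, h3, h4.imp ?_⟩
        intro x y h; exact (Finset.mem_sdiff.1 h).1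
    · intro i j
      refine Fin.cases ?_ (fun i => ?_) i <;> refine Fin.cases ?_ (fun j => ?_) j
      · intro h; exact absurd rfl h
      · intro _; simpa using hdis j
      · intro _; simpa using (hdis i).symm
      · intro h; simpa using hd (fun e => h (by rw [e]))

open Classical in
theorem menger (V : Finset ℕ) (A : Finset (ℕ × ℕ))
    (hA : ∀ a ∈ A, a.1 ∈ V ∧ a.2 ∈ V) (u v : ℕ) (hu : u ∈ V) (n : ℕ)
    (hcut : ∀ X ⊆ V, u ∈ X → v ∉ X → n ≤ (A.filter fun a => a.1 ∈ X ∧ a.2 ∉ X).card) :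
    ∃ P : Fin n → List ℕ, (∀ i, (P i).Nodup ∧ (P i).head? = some u ∧ (P i).getLast? = some v ∧
      (P i).IsChain (fun x y => (x, y) ∈ A)) ∧
      Pairwise fun i j => Disjoint (Dgraph.arcsOf (P i)) (Dgraph.arcsOf (P j)) := by
  have hflow : ∀ m ≤ n, ∃ F ⊆ A, ∀ w, net F w = m * dl u w - m * dl v w := by
    intro m
    induction m with
    | zero => intro _; exact ⟨∅, by simp, by simp [net]⟩
    | succ m ih =>
      intro hm
      obtain ⟨F, hF, hnet⟩ := ih (by omega)
      set R : ℕ → ℕ → Prop := fun x y => ((x, y) ∈ A ∧ (x, y) ∉ F) ∨ (y, x) ∈ F with hR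
      have hreach : Relation.ReflTransGen R u v := by
        by_contra hcon
        set X := V.filter fun x => Relation.ReflTransGen R u x with hX
        have h1 := net_cut F X
        have huX : u ∈ X := by simp [hX, hu]; exact Relation.ReflTransGen.refl
        have hvX : v ∉ X := by simp [hX, hcon]
        have hc := hcut X (Finset.filter_subset _ _) huX hvX
        have h2 : (F.filter fun a => a.1 ∉ X ∧ a.2 ∈ X) = ∅ := by
          rw [Finset.filter_eq_empty_iff]
          rintro ⟨x, y⟩ hxy ⟨hx, hy⟩
          apply hx
          simp only [hX, Finset.mem_filter] at hy ⊢
          exact ⟨(hA _ (hF hxy)).1, hy.2.tail (Or.inr hxy)⟩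
        have h3 : (A.filter fun a => a.1 ∈ X ∧ a.2 ∉ X) ⊆ (F.filter fun a => a.1 ∈ X ∧ a.2 ∉ X) := by
          rintro ⟨x, y⟩ hxy
          simp only [Finset.mem_filter] at hxy ⊢
          refine ⟨?_, hxy.2⟩
          by_contra hnF
          apply hxy.2.2
          have hx := hxy.2.1
          simp only [hX, Finset.mem_filter] at hx ⊢
          exact ⟨(hA _ hxy.1).2, hx.2.tail (Or.inl ⟨hxy.1, hnF⟩)⟩
        have h4 := Finset.card_le_card h3
        rw [h2, Finset.sum_congr rfl (fun w _ => hnet w), Finset.sum_sub_distrib,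
          ← Finset.mul_sum, ← Finset.mul_sum, sum_dl, sum_dl, if_pos huX, if_neg hvX] at h1
        simp at h1
        omega
      obtain ⟨t, hn, hc, hl⟩ := exists_nodup_path hreach
      obtain ⟨F', hF', h⟩ := augment A v t u F hF hn hc hl
      refine ⟨F', hF', fun w => ?_⟩
      rw [h w, hnet w]; push_cast; ring
  obtain ⟨F, hF, hnet⟩ := hflow n le_rfl
  obtain ⟨P, hP, hd⟩ := flow_decomp V A hA u v hu n F hF hnet
  refine ⟨P, fun i => ?_, hd⟩
  obtain ⟨h1, h2, h3, h4⟩ := hP i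
  exact ⟨h1, h2, h3, h4.imp fun x y h => hF h⟩

end DgAux

namespace DgAux

/-- Monochromatic arcs inside `S`. -/
def mono {k : ℕ} (r : ℕ → ℕ → Prop) (S : Finset ℕ) (f : ℕ → Fin k) (a b : ℕ) : Prop :=
  r a b ∧ a ∈ S ∧ b ∈ S ∧ f a = f b

/-- `f` is a dicolouring of the subdigraph induced by `S`. -/
def Good {k : ℕ} (r : ℕ → ℕ → Prop) (S : Finset ℕ) (f : ℕ → Fin k) : Prop :=
  ∀ a, ¬ Relation.TransGen (mono r S f) a a

/-- The reversed relation. -/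
def rev (r : ℕ → ℕ → Prop) (a b : ℕ) : Prop := r b a

theorem rev_rev (r : ℕ → ℕ → Prop) : rev (rev r) = r := rfl

section
variable {k : ℕ} {r : ℕ → ℕ → Prop} {S T V B : Finset ℕ} {f f' : ℕ → Fin k} {u v : ℕ}

theorem Good.subset (h : Good r S f) (hT : T ⊆ S) : Good r T f := fun a ha =>
  h a (ha.lift id (fun _ _ h => ⟨h.1, hT h.2.1, hT h.2.2.1, h.2.2.2⟩))

theorem Good.rev (h : Good r S f) : Good (rev r) S f := by
  intro a ha
  apply h a
  rw [← Relation.transGen_swap]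
  refine ha.lift id ?_
  rintro x y ⟨h1, h2, h3, h4⟩
  exact ⟨h1, h3, h2, h4.symm⟩

theorem Good.extend (h : Good r (S.erase v) f) (hf : ∀ u, u ≠ v → f' u = f u)
    (hv : ∀ u ∈ S, r v u → f' u ≠ f' v) : Good r S f' := by
  have hne : ∀ a b, mono r S f' a b → a ≠ v := by
    rintro a b ⟨h1, _, h3, h4⟩ rfl
    exact hv b h3 h1 h4.symm
  have key : ∀ a b, Relation.TransGen (mono r S f') a b → b ≠ v →
      a ≠ v ∧ Relation.TransGen (mono r (S.erase v) f) a b := by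
    intro a b hab
    have one : ∀ a b, mono r S f' a b → b ≠ v → mono r (S.erase v) f a b := by
      intro a b hab hb
      have ha := hne a b hab
      obtain ⟨h1, h2, h3, h4⟩ := hab
      refine ⟨h1, Finset.mem_erase.2 ⟨ha, h2⟩, Finset.mem_erase.2 ⟨hb, h3⟩, ?_⟩
      rw [← hf a ha, ← hf b hb, h4]
    induction hab with
    | single hab =>
      intro hb
      exact ⟨hne _ _ hab, Relation.TransGen.single (one _ _ hab hb)⟩
    | tail _ hbc ih =>
      intro hc
      obtain ⟨h1, h2⟩ := ih (hne _ _ hbc)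
      exact ⟨h1, h2.tail (one _ _ hbc hc)⟩
  intro a ha
  have hav : a ≠ v := by
    obtain ⟨b, hb, _⟩ := Relation.TransGen.head'_iff.1 ha
    exact hne _ _ hb
  exact h a (key a a ha hav).2

/-- The digraph is loopless and not `k`-colourable. -/
structure Ctx (k : ℕ) (V : Finset ℕ) (r : ℕ → ℕ → Prop) : Prop where
  irr : ∀ a, ¬ r a a
  nc : ∀ f : ℕ → Fin k, ¬ Good r V f

theorem Ctx.rev (C : Ctx k V r) : Ctx k V (rev r) :=
  ⟨fun a h => C.irr a h, fun f h => C.nc f h.rev⟩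

open Classical in
/-- Out-neighbours of `v` in `V`. -/
noncomputable def Nout (r : ℕ → ℕ → Prop) (V : Finset ℕ) (v : ℕ) : Finset ℕ := V.filter fun u => r v u

theorem mem_Nout : u ∈ Nout r V v ↔ u ∈ V ∧ r v u := by simp [Nout]

/-- `v` has in- and out-degree `k`. -/
def Reg (k : ℕ) (r : ℕ → ℕ → Prop) (V : Finset ℕ) (v : ℕ) : Prop :=
  v ∈ V ∧ (Nout r V v).card = k ∧ (Nout (rev r) V v).card = k

theorem Reg.rev (h : Reg k r V v) : Reg k (rev r) V v := ⟨h.1, h.2.2, h.2.1⟩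

theorem surj (C : Ctx k V r) (h : Good r (V.erase v) f) (c : Fin k) :
    ∃ u ∈ Nout r V v, f u = c := by
  by_contra hcon
  push Not at hcon
  refine C.nc (Function.update f v c) (h.extend (fun u hu => Function.update_of_ne hu _ _) ?_)
  intro u hu hvu
  have huv : u ≠ v := by rintro rfl; exact C.irr _ hvu
  rw [Function.update_of_ne huv, Function.update_self]
  exact hcon u (mem_Nout.2 ⟨hu, hvu⟩)

theorem inj (C : Ctx k V r) (hr : Reg k r V v) (h : Good r (V.erase v) f) :
    Set.InjOn f (Nout r V v : Set ℕ) := by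
  apply Finset.injOn_of_surjOn_of_card_le (t := Finset.univ) f (fun x _ => by simp)
  · intro c _
    obtain ⟨u, hu, hc⟩ := surj C h c
    exact ⟨u, hu, hc⟩
  · rw [hr.2.1]; simp

def adj (r : ℕ → ℕ → Prop) (a b : ℕ) : Prop := r a b ∨ r b a

theorem adj.symm (h : adj r u v) : adj r v u := Or.symm h

theorem move_out (C : Ctx k V r) (hr : Reg k r V v) (hu : u ∈ V) (hvu : r v u)
    (h : Good r (V.erase v) f) : Good r (V.erase u) (Function.update f v (f u)) := by
  have h' : Good r ((V.erase u).erase v) f :=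
    h.subset (Finset.erase_subset_erase _ (Finset.erase_subset _ _))
  refine h'.extend (fun w hw => Function.update_of_ne hw _ _) ?_
  intro w hw hvw
  have hwv : w ≠ v := by rintro rfl; exact C.irr _ hvw
  rw [Function.update_of_ne hwv, Function.update_self]
  intro he
  have := inj C hr h (mem_Nout.2 ⟨Finset.mem_of_mem_erase hw, hvw⟩) (mem_Nout.2 ⟨hu, hvu⟩) he
  exact (Finset.mem_erase.1 hw).1 this

theorem move (C : Ctx k V r) (hr : Reg k r V v) (hu : u ∈ V) (hvu : adj r v u)
    (h : Good r (V.erase v) f) : Good r (V.erase u) (Function.update f v (f u)) := by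
  rcases hvu with hvu | hvu
  · exact move_out C hr hu hvu h
  · have := move_out C.rev hr.rev hu hvu h.rev
    exact this.rev

/-- Moving the hole inside `B`. -/
def Mv (r : ℕ → ℕ → Prop) (B : Finset ℕ) (p q : ℕ × (ℕ → Fin k)) : Prop :=
  p.1 ∈ B ∧ q.1 ∈ B ∧ q.1 ≠ p.1 ∧ adj r p.1 q.1 ∧ q.2 = Function.update p.2 p.1 (p.2 q.1)

abbrev Rch (r : ℕ → ℕ → Prop) (B : Finset ℕ) : ℕ × (ℕ → Fin k) → ℕ × (ℕ → Fin k) → Prop :=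
  Relation.ReflTransGen (Mv r B)

theorem Rch.good (C : Ctx k V r) (hB : ∀ b ∈ B, Reg k r V b) {p q : ℕ × (ℕ → Fin k)}
    (h : Rch r B p q) (hp : Good r (V.erase p.1) p.2) : Good r (V.erase q.1) q.2 := by
  induction h with
  | refl => exact hp
  | tail _ hm ih =>
    obtain ⟨h1, h2, h3, h4, h5⟩ := hm
    rw [h5]
    exact move C (hB _ h1) (hB _ h2).1 h4 ih

theorem Rch.off {p q : ℕ × (ℕ → Fin k)} (h : Rch r B p q) {w : ℕ} (hw : w ∉ B) :
    q.2 w = p.2 w := by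
  induction h with
  | refl => rfl
  | tail _ hm ih =>
    obtain ⟨h1, h2, h3, h4, h5⟩ := hm
    rw [h5, Function.update_of_ne (fun e : w = _ => hw (by rw [e]; exact h1)), ih]

theorem Rch.mset {p q : ℕ × (ℕ → Fin k)} (h : Rch r B p q) :
    (B.erase q.1).val.map q.2 = (B.erase p.1).val.map p.2 := by
  induction h with
  | refl => rfl
  | @tail a b _ hm ih =>
    obtain ⟨h1, h2, h3, h4, h5⟩ := hm
    rw [← ih, h5]
    have e1 : B.erase b.1 = insert a.1 ((B.erase a.1).erase b.1) := by
      ext w; simp only [Finset.mem_erase, Finset.mem_insert]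
      by_cases hwa : w = a.1
      · simp [hwa, h1, h3.symm]
      · simp [hwa]
    have e2 : B.erase a.1 = insert b.1 ((B.erase a.1).erase b.1) := by
      rw [Finset.insert_erase]; exact Finset.mem_erase.2 ⟨h3, h2⟩
    rw [e1]
    conv_rhs => rw [e2]
    rw [Finset.insert_val_of_notMem (by simp), Finset.insert_val_of_notMem (by simp)]
    simp only [Multiset.map_cons, Function.update_self]
    congr 1
    apply Multiset.map_congr rfl
    intro x hx
    have : x ∈ (B.erase a.1).erase b.1 := hx
    simp only [Finset.mem_erase] at this
    rw [Function.update_of_ne this.2.1]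

/-- adjacency inside `S` -/
def adjIn (r : ℕ → ℕ → Prop) (S : Finset ℕ) (a b : ℕ) : Prop := a ∈ S ∧ b ∈ S ∧ adj r a b

def Conn (r : ℕ → ℕ → Prop) (S : Finset ℕ) : Prop :=
  ∀ a ∈ S, ∀ b ∈ S, Relation.ReflTransGen (adjIn r S) a b

theorem hole_move (irr : ∀ a, ¬ r a a) {y : ℕ} (hvw : Relation.ReflTransGen (adjIn r (B.erase y)) v u) (f : ℕ → Fin k) :
    ∃ f', Rch r B (v, f) (u, f') ∧ f' y = f y := by
  induction hvw with
  | refl => exact ⟨f, Relation.ReflTransGen.refl, rfl⟩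
  | @tail b c _ hbc ih =>
    obtain ⟨f', h1, h2⟩ := ih
    obtain ⟨hb, hc, hadj⟩ := hbc
    simp only [Finset.mem_erase] at hb hc
    refine ⟨Function.update f' b (f' c), h1.tail ⟨hb.2, hc.2, ?_, hadj, rfl⟩, ?_⟩
    · rintro h
      simp only at h
      subst h
      rcases hadj with h | h <;> exact irr _ h
    · rw [Function.update_of_ne hb.1.symm, h2]

/-- 2-connectedness of the induced subdigraph. -/
def TwoConn (r : ℕ → ℕ → Prop) (B : Finset ℕ) : Prop := ∀ b ∈ B, Conn r (B.erase b)

theorem transport1 (irr : ∀ a, ¬ r a a) (h2 : TwoConn r B) (hv : v ∈ B) {y z : ℕ}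
    (hyz : adjIn r (B.erase v) y z) (f : ℕ → Fin k) :
    ∃ f', Rch r B (v, f) (v, f') ∧ f' z = f y := by
  obtain ⟨hy, hz, hadj⟩ := hyz
  have hne : y ≠ z := by
    rintro rfl
    rcases hadj with h | h <;> exact irr _ h
  simp only [Finset.mem_erase] at hy hz
  obtain ⟨f1, hr1, hf1⟩ := hole_move irr (h2 y hy.2 v (Finset.mem_erase.2 ⟨hy.1.symm, hv⟩) z
    (Finset.mem_erase.2 ⟨hne.symm, hz.2⟩)) f
  have hr2 : Rch r B (z, f1) (y, Function.update f1 z (f1 y)) :=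
    Relation.ReflTransGen.single ⟨hz.2, hy.2, hne, hadj.symm, rfl⟩
  obtain ⟨f3, hr3, hf3⟩ := hole_move irr (h2 z hz.2 y (Finset.mem_erase.2 ⟨hne, hy.2⟩) v
    (Finset.mem_erase.2 ⟨hz.1.symm, hv⟩)) (Function.update f1 z (f1 y))
  refine ⟨f3, (hr1.trans hr2).trans hr3, ?_⟩
  rw [hf3, Function.update_self, hf1]

theorem transport (irr : ∀ a, ¬ r a a) (h2 : TwoConn r B) (hv : v ∈ B) {y z : ℕ}
    (hy : y ∈ B.erase v) (hz : z ∈ B.erase v) (f : ℕ → Fin k) :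
    ∃ f', Rch r B (v, f) (v, f') ∧ f' z = f y := by
  have := h2 v hv y hy z hz
  clear hz
  induction this with
  | refl => exact ⟨f, Relation.ReflTransGen.refl, rfl⟩
  | tail _ hbc ih =>
    obtain ⟨f1, h1, hf1⟩ := ih
    obtain ⟨f3, h3, hf3⟩ := transport1 irr h2 hv hbc f1
    exact ⟨f3, h1.trans h3, hf3.trans hf1⟩

/-- All colours on `B - v` appear on the out-neighbours of `v` in `B`. -/
theorem colours_out (C : Ctx k V r) (hB : ∀ b ∈ B, Reg k r V b) (h2 : TwoConn r B) (hv : v ∈ B)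
    (h : Good r (V.erase v) f) (hI : (Nout r B v).Nonempty) {y : ℕ} (hy : y ∈ B.erase v) :
    ∃ u ∈ Nout r B v, f u = f y := by
  obtain ⟨i, hi⟩ := hI
  rw [mem_Nout] at hi
  have hiv : i ≠ v := by rintro rfl; exact C.irr _ hi.2
  obtain ⟨f', hr, hf'⟩ := transport C.irr h2 hv hy (Finset.mem_erase.2 ⟨hiv, hi.1⟩) f
  obtain ⟨u, hu, hfu⟩ := surj C h (f y)
  rw [mem_Nout] at hu
  by_cases huB : u ∈ B
  · exact ⟨u, mem_Nout.2 ⟨huB, hu.2⟩, hfu⟩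
  · exfalso
    have hg := Rch.good C hB hr h
    have := inj C (hB v hv) hg (mem_Nout.2 hu) (mem_Nout.2 ⟨(hB i hi.1).1, hi.2⟩)
      (by simp only; rw [hf', ← hfu]; exact Rch.off hr huB)
    exact huB (this ▸ hi.1)

theorem Nout_sub (hBV : B ⊆ V) : Nout r B v ⊆ Nout r V v := by
  intro u hu; rw [mem_Nout] at hu ⊢; exact ⟨hBV hu.1, hu.2⟩

/-- number of colours. -/
theorem card_colours (C : Ctx k V r) (hB : ∀ b ∈ B, Reg k r V b) (h2 : TwoConn r B) (hv : v ∈ B)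
    (h : Good r (V.erase v) f) (hI : (Nout r B v).Nonempty) :
    ((B.erase v).image f).card = (Nout r B v).card := by
  have hBV : B ⊆ V := fun b hb => (hB b hb).1
  have e : (B.erase v).image f = (Nout r B v).image f := by
    ext c
    simp only [Finset.mem_image]
    constructor
    · rintro ⟨y, hy, rfl⟩
      exact colours_out C hB h2 hv h hI hy
    · rintro ⟨y, hy, rfl⟩
      refine ⟨y, Finset.mem_erase.2 ⟨?_, (mem_Nout.1 hy).1⟩, rfl⟩
      rintro rfl; exact C.irr _ (mem_Nout.1 hy).2
  rw [e, Finset.card_image_of_injOn]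
  exact (inj C (hB v hv) h).mono (by exact_mod_cast Nout_sub hBV)

theorem Rch.image {p q : ℕ × (ℕ → Fin k)} (h : Rch r B p q) :
    (B.erase q.1).image q.2 = (B.erase p.1).image p.2 := by
  have := h.mset
  unfold Finset.image
  rw [this]

/-- Moving inside a 2-connected set all degrees are equal. -/
theorem card_eq_of_reach (C : Ctx k V r) (hB : ∀ b ∈ B, Reg k r V b) (h2 : TwoConn r B)
    (h : Good r (V.erase v) f) {w : ℕ} {f' : ℕ → Fin k} (hr : Rch r B (v, f) (w, f')) (hw : w ∈ B)
    (hI : (Nout r B w).Nonempty) : (Nout r B w).card = ((B.erase v).image f).card := by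
  rw [← card_colours C hB h2 hw (Rch.good C hB hr h) hI]
  exact congrArg _ hr.image

/-- near-complete implies complete -/
theorem complete_of_small (C : Ctx k V r) (hB : ∀ b ∈ B, Reg k r V b) (h2 : TwoConn r B) (hv : v ∈ B)
    (h : Good r (V.erase v) f) (hI : 2 ≤ (Nout r B v).card)
    (hs : (B.erase v).card ≤ (Nout r B v).card + 1) : Nout r B v = B.erase v := by
  have hsub : Nout r B v ⊆ B.erase v := by
    intro y hy
    refine Finset.mem_erase.2 ⟨?_, (mem_Nout.1 hy).1⟩
    rintro rfl; exact C.irr _ (mem_Nout.1 hy).2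
  by_contra hne
  obtain ⟨z, hz, hzI⟩ := Finset.exists_of_ssubset (hsub.ssubset_of_ne hne)
  have hIne : (Nout r B v).Nonempty := Finset.card_pos.1 (by omega)
  have hBV : B ⊆ V := fun b hb => (hB b hb).1
  have hins : B.erase v = insert z (Nout r B v) := by
    symm
    apply Finset.eq_of_subset_of_card_le
    · exact Finset.insert_subset hz hsub
    · rw [Finset.card_insert_of_notMem hzI]; exact hs
  obtain ⟨u, hu, hfu⟩ := colours_out C hB h2 hv h hIne hz
  obtain ⟨y, hy, hyu⟩ := Finset.exists_mem_ne (by omega : 1 < (Nout r B v).card) u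
  have hinj := (inj C (hB v hv) h)
  have hcnt : Multiset.count (f y) ((B.erase v).val.map f) = 1 := by
    rw [hins, Finset.insert_val_of_notMem hzI, Multiset.map_cons, Multiset.count_cons_of_ne]
    · rw [Multiset.count_eq_one_of_mem]
      · rw [Multiset.nodup_map_iff_inj_on (Nout r B v).nodup]
        intro a ha b hb hab
        exact hinj (Nout_sub hBV ha) (Nout_sub hBV hb) hab
      · exact Multiset.mem_map_of_mem f hy
    · rw [← hfu]
      intro he
      exact hyu (hinj (Nout_sub hBV hy) (Nout_sub hBV hu) he)
  obtain ⟨f', hr, hf'⟩ := transport C.irr h2 hv (hsub hy) hz f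
  have hg := Rch.good C hB hr h
  obtain ⟨w, hw, hfw⟩ := colours_out C hB h2 hv hg hIne hz
  have hm : Multiset.map f' (B.erase v).val = Multiset.map f (B.erase v).val := hr.mset
  have hfw : f' w = f' z := hfw
  rw [← hm, hins, Finset.insert_val_of_notMem hzI, Multiset.map_cons, hf', Multiset.count_cons_self] at hcnt
  have : 0 < Multiset.count (f y) (Multiset.map f' (Nout r B v).val) := by
    rw [Multiset.count_pos, Multiset.mem_map]
    exact ⟨w, hw, by rw [hfw, hf']⟩
  omega

end
end DgAux

namespace DgAux
section
variable {k : ℕ} {r : ℕ → ℕ → Prop} {S T V B W : Finset ℕ} {f f' : ℕ → Fin k} {u v : ℕ}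

theorem adj_rev (r : ℕ → ℕ → Prop) : adj (rev r) = adj r := by
  funext a b; exact propext or_comm

theorem TwoConn.rev (h : TwoConn r B) : TwoConn (rev r) B := by
  have e : adjIn (DgAux.rev r) = adjIn r := by
    funext S a b
    simp only [adjIn, adj_rev]
  simpa only [TwoConn, Conn, e] using h

theorem Rch.rev {p q : ℕ × (ℕ → Fin k)} (h : Rch r B p q) : Rch (rev r) B p q := by
  induction h with
  | refl => exact Relation.ReflTransGen.refl
  | tail _ hs ih =>
    obtain ⟨h1, h2, h3, h4, h5⟩ := hs
    exact Relation.ReflTransGen.tail ih ⟨h1, h2, h3, by rw [adj_rev]; exact h4, h5⟩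

theorem adjIn_symm {a b : ℕ} (h : Relation.ReflTransGen (adjIn r S) a b) :
    Relation.ReflTransGen (adjIn r S) b a := by
  induction h with
  | refl => exact Relation.ReflTransGen.refl
  | tail _ hbc ih => exact Relation.ReflTransGen.head ⟨hbc.2.1, hbc.1, hbc.2.2.symm⟩ ih

/-- `Q` is a union of components of `W - c`. -/
def Closed (r : ℕ → ℕ → Prop) (W : Finset ℕ) (c : ℕ) (Q : Finset ℕ) : Prop :=
  Q ⊆ W.erase c ∧ Q.Nonempty ∧ ∀ q ∈ Q, ∀ w ∈ W, adj r q w → w = c ∨ w ∈ Q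

open Classical in
/-- Existence of end blocks. -/
theorem end_block (r : ℕ → ℕ → Prop) (W : Finset ℕ) : ∀ (n : ℕ) (c : ℕ) (Q : Finset ℕ), Q.card = n →
    c ∈ W → Closed r W c Q →
    ∃ c' ∈ W, ∃ Q' ⊆ Q, Closed r W c' Q' ∧ TwoConn r (insert c' Q') := by
  intro n
  induction n using Nat.strong_induction_on with
  | _ n ih =>
    intro c Q hn hc hcl
    by_cases h2 : TwoConn r (insert c Q)
    · exact ⟨c, hc, Q, subset_rfl, hcl, h2⟩
    unfold TwoConn at h2
    push Not at h2
    obtain ⟨b, hb, hnc⟩ := h2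
    set E := (insert c Q).erase b with hE
    obtain ⟨hQ, hQne, hcl'⟩ := hcl
    have hcQ : c ∉ Q := fun h => (Finset.mem_erase.1 (hQ h)).1 rfl
    have hQW : Q ⊆ W := hQ.trans (Finset.erase_subset _ _)
    unfold Conn at hnc
    push Not at hnc
    obtain ⟨a, ha, a', ha', hna⟩ := hnc
    have key : ∃ t ∈ E, c ∉ E.filter (fun e => Relation.ReflTransGen (adjIn r E) t e) ∧
        ∃ s ∈ Q, s ∉ E.filter (fun e => Relation.ReflTransGen (adjIn r E) t e) := by
      by_cases hbc : b = c
      · refine ⟨a, ha, ?_, a', ?_, ?_⟩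
        · simp [hE, hbc]
        · have := ha'
          simp only [hE, hbc, Finset.mem_erase, Finset.mem_insert] at this
          tauto
        · simp [hna]
      · have hbQ : b ∈ Q := by
          rcases Finset.mem_insert.1 hb with h | h
          · exact absurd h hbc
          · exact h
        by_cases hac : Relation.ReflTransGen (adjIn r E) a c
        · refine ⟨a', ha', ?_, b, hbQ, by simp [hE]⟩
          intro h
          exact hna (hac.trans (adjIn_symm (Finset.mem_filter.1 h).2))
        · refine ⟨a, ha, ?_, b, hbQ, by simp [hE]⟩
          intro h
          exact hac (Finset.mem_filter.1 h).2
    obtain ⟨t, ht, hcQ1, s, hs, hsQ1⟩ := key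
    set Q1 := E.filter (fun e => Relation.ReflTransGen (adjIn r E) t e) with hQ1
    have hQ1Q : Q1 ⊆ Q := by
      intro e he
      have h1 := (Finset.mem_filter.1 he).1
      rw [hE, Finset.mem_erase, Finset.mem_insert] at h1
      rcases h1.2 with h | h
      · exact absurd (h ▸ he) hcQ1
      · exact h
    have hlt : Q1.card < n := by
      rw [← hn]
      exact Finset.card_lt_card ⟨hQ1Q, fun h => hsQ1 (h hs)⟩
    have hbW : b ∈ W := by
      rcases Finset.mem_insert.1 hb with h | h
      · rw [h]; exact hc
      · exact hQW h
    suffices hcl1 : Closed r W b Q1 by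
      obtain ⟨c', hc', Q', hQ', h3, h4⟩ := ih _ hlt b Q1 rfl hbW hcl1
      exact ⟨c', hc', Q', hQ'.trans hQ1Q, h3, h4⟩
    refine ⟨?_, ⟨t, ?_⟩, ?_⟩
    · intro e he
      exact Finset.mem_erase.2 ⟨(Finset.mem_erase.1 (Finset.mem_filter.1 he).1).1, hQW (hQ1Q he)⟩
    · exact Finset.mem_filter.2 ⟨ht, Relation.ReflTransGen.refl⟩
    · intro q hq w hw hadj
      by_cases hwb : w = b
      · exact Or.inl hwb
      · right
        have hwE : w ∈ E := by
          rw [hE, Finset.mem_erase, Finset.mem_insert]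
          exact ⟨hwb, hcl' q (hQ1Q hq) w hw hadj⟩
        have hq' := Finset.mem_filter.1 hq
        exact Finset.mem_filter.2 ⟨hwE, hq'.2.tail ⟨hq'.1, hwE, hadj⟩⟩

open Classical in
theorem Nout_step {x q : ℕ} (hx : x ∈ V) (hxB : x ∉ B) (hBV : B ⊆ V)
    (h : ∀ w ∈ V, w ≠ x → r q w → w ∈ B) :
    (Nout r V q).card = (Nout r B q).card + (if r q x then 1 else 0) := by
  have hxn : x ∉ Nout r B q := fun h => hxB (mem_Nout.1 h).1
  split_ifs with hq
  · rw [← Finset.card_insert_of_notMem hxn]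
    congr 1
    ext w
    rw [Finset.mem_insert, mem_Nout, mem_Nout]
    constructor
    · rintro ⟨h1, h2⟩
      by_cases hw : w = x
      · exact Or.inl hw
      · exact Or.inr ⟨h w h1 hw h2, h2⟩
    · rintro (rfl | ⟨h1, h2⟩)
      · exact ⟨hx, hq⟩
      · exact ⟨hBV h1, h2⟩
  · rw [add_zero]
    congr 1
    ext w
    rw [mem_Nout, mem_Nout]
    constructor
    · rintro ⟨h1, h2⟩
      exact ⟨h w h1 (by rintro rfl; exact hq h2) h2, h2⟩
    · rintro ⟨h1, h2⟩
      exact ⟨hBV h1, h2⟩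

theorem reach_all (irr : ∀ a, ¬ r a a) (h2 : TwoConn r B) (h3 : 3 ≤ B.card) (hv : v ∈ B) (hu : u ∈ B)
    (f : ℕ → Fin k) : ∃ f', Rch r B (v, f) (u, f') := by
  have : ∃ y ∈ B, y ∉ ({v, u} : Finset ℕ) := by
    apply Finset.exists_mem_notMem_of_card_lt_card
    have := Finset.card_le_two (a := v) (b := u)
    omega
  obtain ⟨y, hy, hyn⟩ := this
  simp only [Finset.mem_insert, Finset.mem_singleton, not_or] at hyn
  obtain ⟨f', h, _⟩ := hole_move irr (h2 y hy v (Finset.mem_erase.2 ⟨Ne.symm hyn.1, hv⟩) u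
    (Finset.mem_erase.2 ⟨Ne.symm hyn.2, hu⟩)) f
  exact ⟨f', h⟩

theorem exit_arc {a b : ℕ} {Q : Finset ℕ} (h : Relation.ReflTransGen (adjIn r S) a b)
    (ha : a ∈ Q) (hb : b ∉ Q) : ∃ p ∈ Q, ∃ s, s ∉ Q ∧ adjIn r S p s := by
  induction h with
  | refl => exact absurd ha hb
  | @tail c d _ hcd ih =>
    by_cases hc : c ∈ Q
    · exact ⟨c, hc, d, hb, hcd⟩
    · exact ih hc

theorem sum_Nout (r : ℕ → ℕ → Prop) (B : Finset ℕ) :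
    ∑ b ∈ B, (Nout r B b).card = ∑ b ∈ B, (Nout (rev r) B b).card := by
  classical
  simp only [Nout, Finset.card_filter]
  rw [Finset.sum_comm]
  rfl

theorem Nout_sub_erase (irr : ∀ a, ¬ r a a) : Nout r B v ⊆ B.erase v := by
  intro y hy
  refine Finset.mem_erase.2 ⟨?_, (mem_Nout.1 hy).1⟩
  rintro rfl; exact irr _ (mem_Nout.1 hy).2

/-- Second level analysis: end blocks of `B - i`. -/
theorem second (C : Ctx k V r) (crit : ∀ v ∈ V, ∃ f : ℕ → Fin k, Good r (V.erase v) f)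
    (hB : ∀ b ∈ B, Reg k r V b) (h2 : TwoConn r B) {n : ℕ} (hn : 3 ≤ n)
    (hN : ∀ b ∈ B, (Nout r B b).card = n ∧ (Nout (rev r) B b).card = n)
    {i : ℕ} (hi : i ∈ B) {c : ℕ} {Q0 : Finset ℕ} (hc : c ∈ B.erase i)
    (hQ0 : Closed r (B.erase i) c Q0) :
    ∃ c' ∈ B.erase i, ∃ Q' ⊆ Q0, Closed r (B.erase i) c' Q' ∧ Q' ⊆ Nout r B i ∧ n ≤ Q'.card + 1 := by
  classical
  obtain ⟨c', hc', Q', hQ', hcl, h2'⟩ := end_block r (B.erase i) _ c Q0 rfl hc hQ0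
  refine ⟨c', hc', Q', hQ', hcl, ?_⟩
  obtain ⟨hs, ⟨q, hq⟩, hcl'⟩ := hcl
  have hQB : Q' ⊆ B := fun a ha => Finset.mem_of_mem_erase (Finset.mem_of_mem_erase (hs ha))
  have hc'B : c' ∈ B := Finset.mem_of_mem_erase hc'
  have hc'i : c' ≠ i := (Finset.mem_erase.1 hc').1
  have hiQ : i ∉ Q' := fun h =>
    (Finset.mem_erase.1 (Finset.mem_of_mem_erase (hs h))).1 rfl
  have hc'Q : c' ∉ Q' := fun h => (Finset.mem_erase.1 (hs h)).1 rfl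
  have hB'B : insert c' Q' ⊆ B := Finset.insert_subset hc'B hQB
  have hiB' : i ∉ insert c' Q' := by simp [hiQ, hc'i.symm]
  have hB' : ∀ b ∈ insert c' Q', Reg k r V b := fun b hb => hB b (hB'B hb)
  obtain ⟨v0, hv0, s, hsQ, hsS⟩ := exit_arc (Q := Q') (h2 c' hc'B q
    (Finset.mem_erase.2 ⟨fun h => hc'Q (h ▸ hq), hQB hq⟩) i
    (Finset.mem_erase.2 ⟨hc'i.symm, hi⟩)) hq hiQ
  have hsi : s = i := by
    by_contra hne
    have h1 := Finset.mem_erase.1 hsS.2.1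
    rcases hcl' v0 hv0 s (Finset.mem_erase.2 ⟨hne, h1.2⟩) hsS.2.2 with h | h
    · exact h1.1 h
    · exact hsQ h
  have hadj : adj r v0 i := hsi ▸ hsS.2.2
  have hout : ∀ v ∈ Q', n = (Nout r (insert c' Q') v).card + (if r v i then 1 else 0) := by
    intro v hv
    rw [← (hN v (hQB hv)).1]
    apply Nout_step hi hiB' hB'B
    intro w hw hwi hvw
    rw [Finset.mem_insert]
    exact hcl' v hv w (Finset.mem_erase.2 ⟨hwi, hw⟩) (Or.inl hvw)
  have hin : ∀ v ∈ Q', n = (Nout (rev r) (insert c' Q') v).card + (if r i v then 1 else 0) := by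
    intro v hv
    rw [← (hN v (hQB hv)).2]
    apply Nout_step hi hiB' hB'B
    intro w hw hwi hvw
    rw [Finset.mem_insert]
    exact hcl' v hv w (Finset.mem_erase.2 ⟨hwi, hw⟩) (Or.inr hvw)
  have hcard : ∀ v ∈ Q', (Nout r (insert c' Q') v).card ≤ Q'.card := by
    intro v hv
    have := Finset.card_le_card (Nout_sub_erase (r := r) (B := insert c' Q') (v := v) C.irr)
    rwa [Finset.card_erase_of_mem (Finset.mem_insert_of_mem hv),
      Finset.card_insert_of_notMem hc'Q, Nat.add_sub_cancel] at this
  have h3 : 3 ≤ (insert c' Q').card := by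
    rw [Finset.card_insert_of_notMem hc'Q]
    have a1 := hout v0 hv0
    have a2 := hcard v0 hv0
    split_ifs at a1 <;> omega
  obtain ⟨f, hf⟩ := crit v0 (hB v0 (hQB hv0)).1
  have hall : ∀ v ∈ Q',
      (Nout r (insert c' Q') v).card = (((insert c' Q').erase v0).image f).card ∧
      (Nout (rev r) (insert c' Q') v).card = (((insert c' Q').erase v0).image f).card := by
    intro v hv
    obtain ⟨f', hr⟩ := reach_all C.irr h2' h3 (Finset.mem_insert_of_mem hv0)
      (Finset.mem_insert_of_mem hv) f
    constructor
    · apply card_eq_of_reach C hB' h2' hf hr (Finset.mem_insert_of_mem hv)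
      have a1 := hout v hv
      apply Finset.card_pos.1
      split_ifs at a1 <;> omega
    · apply card_eq_of_reach C.rev (fun b hb => (hB' b hb).rev) h2'.rev hf.rev hr.rev
        (Finset.mem_insert_of_mem hv)
      have a1 := hin v hv
      apply Finset.card_pos.1
      split_ifs at a1 <;> omega
  constructor
  · intro v hv
    rw [mem_Nout]
    refine ⟨hQB hv, ?_⟩
    by_contra hiv
    have b1 := hin v hv
    have b2 := hout v0 hv0
    have b3 := hin v0 hv0
    rw [if_neg hiv, (hall v hv).2] at b1
    rw [(hall v0 hv0).1] at b2
    rw [(hall v0 hv0).2] at b3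
    rcases hadj with h | h
    · rw [if_pos h] at b2; omega
    · rw [if_pos h] at b3; omega
  · have a1 := hout v0 hv0
    have a2 := hcard v0 hv0
    split_ifs at a1 <;> omega

/-- The core: find a complete bidirected subdigraph on `k` vertices avoiding `x`. -/
theorem core (hk : 4 ≤ k) (C : Ctx k V r) (crit : ∀ v ∈ V, ∃ f : ℕ → Fin k, Good r (V.erase v) f)
    {x : ℕ} (hx : x ∈ V) (hreg : ∀ v ∈ V, v ≠ x → Reg k r V v) (hV : 3 ≤ V.card) :
    ∃ B ⊆ V.erase x, B.card = k ∧ ∀ b ∈ B, Nout r B b = B.erase b := by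
  classical
  have hcW : 2 ≤ (V.erase x).card := by rw [Finset.card_erase_of_mem hx]; omega
  obtain ⟨c, hc⟩ : (V.erase x).Nonempty := Finset.card_pos.1 (by omega)
  obtain ⟨c0, hc0, Q, -, hcl, h2⟩ := end_block r (V.erase x) _ c ((V.erase x).erase c) rfl hc
    ⟨subset_rfl, Finset.card_pos.1 (by rw [Finset.card_erase_of_mem hc]; omega), by
      intro q _ w hw _
      by_cases h : w = c
      · exact Or.inl h
      · exact Or.inr (Finset.mem_erase.2 ⟨h, hw⟩)⟩
  obtain ⟨hQs, ⟨q0, hq0⟩, hcl'⟩ := hcl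
  have hc0Q : c0 ∉ Q := fun h => (Finset.mem_erase.1 (hQs h)).1 rfl
  set B := insert c0 Q with hBdef
  have hBs : B ⊆ V.erase x := Finset.insert_subset hc0 (hQs.trans (Finset.erase_subset _ _))
  have hBV : B ⊆ V := hBs.trans (Finset.erase_subset _ _)
  have hxB : x ∉ B := fun h => (Finset.mem_erase.1 (hBs h)).1 rfl
  have hB : ∀ b ∈ B, Reg k r V b := fun b hb =>
    hreg b (hBV hb) (Finset.mem_erase.1 (hBs hb)).1
  have hQB : Q ⊆ B := Finset.subset_insert _ _
  have hout : ∀ v ∈ Q, k = (Nout r B v).card + (if r v x then 1 else 0) := by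
    intro v hv
    conv_lhs => rw [← (hB v (hQB hv)).2.1]
    apply Nout_step hx hxB hBV
    intro w hw hwi hvw
    rw [hBdef, Finset.mem_insert]
    exact hcl' v hv w (Finset.mem_erase.2 ⟨hwi, hw⟩) (Or.inl hvw)
  have hin : ∀ v ∈ Q, k = (Nout (rev r) B v).card + (if r x v then 1 else 0) := by
    intro v hv
    conv_lhs => rw [← (hB v (hQB hv)).2.2]
    apply Nout_step hx hxB hBV
    intro w hw hwi hvw
    rw [hBdef, Finset.mem_insert]
    exact hcl' v hv w (Finset.mem_erase.2 ⟨hwi, hw⟩) (Or.inr hvw)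
  have hB3 : 3 ≤ B.card := by
    have := Finset.card_le_card (Nout_sub_erase (r := r) (B := B) (v := q0) C.irr)
    rw [Finset.card_erase_of_mem (hQB hq0)] at this
    have a1 := hout q0 hq0
    split_ifs at a1 <;> omega
  obtain ⟨f, hf⟩ := crit q0 (hB q0 (hQB hq0)).1
  set n := ((B.erase q0).image f).card with hn
  have ho : ∀ b ∈ B, (Nout r B b).Nonempty → (Nout r B b).card = n := by
    intro b hb hne
    obtain ⟨f', hr⟩ := reach_all C.irr h2 hB3 (hQB hq0) hb f
    exact card_eq_of_reach C hB h2 hf hr hb hne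
  have hi : ∀ b ∈ B, (Nout (rev r) B b).Nonempty → (Nout (rev r) B b).card = n := by
    intro b hb hne
    obtain ⟨f', hr⟩ := reach_all C.irr h2 hB3 (hQB hq0) hb f
    exact card_eq_of_reach C.rev (fun b hb => (hB b hb).rev) h2.rev hf.rev hr.rev hb hne
  have hoQ : ∀ b ∈ Q, (Nout r B b).card = n := by
    intro b hb
    apply ho b (hQB hb)
    apply Finset.card_pos.1
    have a1 := hout b hb
    split_ifs at a1 <;> omega
  have hiQ : ∀ b ∈ Q, (Nout (rev r) B b).card = n := by
    intro b hb
    apply hi b (hQB hb)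
    apply Finset.card_pos.1
    have a1 := hin b hb
    split_ifs at a1 <;> omega
  have hn3 : 3 ≤ n := by
    have a1 := hout q0 hq0
    rw [hoQ q0 hq0] at a1
    split_ifs at a1 <;> omega
  have hsum := sum_Nout r B
  have hc0eq : (Nout r B c0).card = (Nout (rev r) B c0).card := by
    rw [hBdef, Finset.sum_insert hc0Q, Finset.sum_insert hc0Q, ← hBdef,
      Finset.sum_congr rfl hoQ, Finset.sum_congr rfl hiQ] at hsum
    omega
  have hc0ne : (Nout r B c0).Nonempty := by
    rw [← Finset.card_pos]
    by_contra h0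
    have e1 : (Nout r B c0) = ∅ := Finset.card_eq_zero.1 (by omega)
    have e2 : (Nout (rev r) B c0) = ∅ := Finset.card_eq_zero.1 (by omega)
    have : ∃ y ∈ B, y ∉ ({c0, q0} : Finset ℕ) := by
      apply Finset.exists_mem_notMem_of_card_lt_card
      have := Finset.card_le_two (a := c0) (b := q0)
      omega
    obtain ⟨y, hy, hyn⟩ := this
    simp only [Finset.mem_insert, Finset.mem_singleton, not_or] at hyn
    obtain ⟨p, hp, s, _, hps⟩ := exit_arc (Q := {c0}) (h2 y hy c0
      (Finset.mem_erase.2 ⟨Ne.symm hyn.1, Finset.mem_insert_self _ _⟩) q0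
      (Finset.mem_erase.2 ⟨Ne.symm hyn.2, hQB hq0⟩)) (by simp)
      (by simp; rintro rfl; exact hc0Q hq0)
    rw [Finset.mem_singleton] at hp
    subst hp
    have hsB := Finset.mem_of_mem_erase hps.2.1
    rcases hps.2.2 with h | h
    · have : s ∈ Nout r B p := mem_Nout.2 ⟨hsB, h⟩
      rw [e1] at this; simp at this
    · have : s ∈ Nout (rev r) B p := mem_Nout.2 ⟨hsB, h⟩
      rw [e2] at this; simp at this
  have hN : ∀ b ∈ B, (Nout r B b).card = n ∧ (Nout (rev r) B b).card = n := by
    intro b hb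
    rcases Finset.mem_insert.1 hb with rfl | hb'
    · have := ho b hb hc0ne
      exact ⟨this, by omega⟩
    · exact ⟨hoQ b hb', hiQ b hb'⟩
  have hBi : 2 ≤ (B.erase q0).card := by rw [Finset.card_erase_of_mem (hQB hq0)]; omega
  obtain ⟨d, hd⟩ : (B.erase q0).Nonempty := Finset.card_pos.1 (by omega)
  obtain ⟨c', hc', Q', -, hclQ', hQ'o, hQ'n⟩ := second C crit hB h2 hn3 hN (hQB hq0) hd
    (Q0 := (B.erase q0).erase d)
    ⟨subset_rfl, Finset.card_pos.1 (by rw [Finset.card_erase_of_mem hd]; omega), by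
      intro q _ w hw _
      by_cases h : w = d
      · exact Or.inl h
      · exact Or.inr (Finset.mem_erase.2 ⟨h, hw⟩)⟩
  have hall : B.erase q0 ⊆ insert c' Q' := by
    by_contra hnot
    obtain ⟨c'', -, Q'', hQ''s, -, hQ''o, hQ''n⟩ := second C crit hB h2 hn3 hN (hQB hq0) hc'
      (Q0 := (B.erase q0) \ insert c' Q')
      ⟨by
        intro w hw
        simp only [Finset.mem_sdiff, Finset.mem_insert, not_or] at hw
        exact Finset.mem_erase.2 ⟨hw.2.1, hw.1⟩,
       Finset.sdiff_nonempty.2 hnot, by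
        intro q hq w hw hadj
        by_cases hwc : w = c'
        · exact Or.inl hwc
        right
        simp only [Finset.mem_sdiff, Finset.mem_insert, not_or] at hq ⊢
        refine ⟨hw, hwc, fun hwQ => ?_⟩
        rcases hclQ'.2.2 w hwQ q hq.1 hadj.symm with h | h
        · exact hq.2.1 h
        · exact hq.2.2 h⟩
    have hdis : Disjoint Q' Q'' := by
      rw [Finset.disjoint_left]
      intro a ha ha'
      exact (Finset.mem_sdiff.1 (hQ''s ha')).2 (Finset.mem_insert_of_mem ha)
    have := Finset.card_le_card (Finset.union_subset hQ'o hQ''o)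
    rw [Finset.card_union_of_disjoint hdis, (hN q0 (hQB hq0)).1] at this
    omega
  have hBcard : B.card ≤ n + 2 := by
    have a1 := Finset.card_le_card hall
    have a2 := Finset.card_insert_le c' Q'
    have a3 := Finset.card_le_card hQ'o
    rw [(hN q0 (hQB hq0)).1] at a3
    rw [Finset.card_erase_of_mem (hQB hq0)] at a1
    omega
  have hcomp : ∀ b ∈ B, Nout r B b = B.erase b := by
    intro b hb
    obtain ⟨g, hg⟩ := crit b (hBV hb)
    apply complete_of_small C hB h2 hb hg
    · rw [(hN b hb).1]; omega
    · rw [(hN b hb).1, Finset.card_erase_of_mem hb]; omega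
  refine ⟨B, hBs, ?_, hcomp⟩
  have hBn : B.card = n + 1 := by
    have := (hN q0 (hQB hq0)).1
    rw [hcomp q0 (hQB hq0), Finset.card_erase_of_mem (hQB hq0)] at this
    omega
  have hnk : n ≠ k := by
    intro hnk
    obtain ⟨g, hg⟩ := crit x hx
    obtain ⟨a, ha, b, hb, hab, hgab⟩ := Finset.exists_ne_map_eq_of_card_lt_of_maps_to
      (s := B) (t := (Finset.univ : Finset (Fin k))) (f := g) (by simp; omega) (fun _ _ => by simp)
    have h1 : b ∈ Nout r B a := by rw [hcomp a ha]; exact Finset.mem_erase.2 ⟨hab.symm, hb⟩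
    have h2 : a ∈ Nout r B b := by rw [hcomp b hb]; exact Finset.mem_erase.2 ⟨hab, ha⟩
    exact hg a ((Relation.TransGen.single ⟨(mem_Nout.1 h1).2, hBs ha, hBs hb, hgab⟩).tail
      ⟨(mem_Nout.1 h2).2, hBs hb, hBs ha, hgab.symm⟩)
  have a1 := hout q0 hq0
  rw [hoQ q0 hq0] at a1
  split_ifs at a1 <;> omega

end
end DgAux

namespace DgAux

theorem chain_reach {s : ℕ → ℕ → Prop} : ∀ (t : List ℕ) (a b : ℕ), (a :: t).IsChain s →
    (a :: t).getLast? = some b → Relation.ReflTransGen s a b := by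
  intro t
  induction t with
  | nil =>
    intro a b _ hl
    simp at hl
    rw [hl]
  | cons c t ih =>
    intro a b hc hl
    rw [List.isChain_cons_cons] at hc
    rw [List.getLast?_cons_cons] at hl
    exact Relation.ReflTransGen.head hc.1 (ih c b hc.2 hl)

theorem chain_mono {k : ℕ} {r : ℕ → ℕ → Prop} {V : Finset ℕ} {f : ℕ → Fin k} {c : Fin k} :
    ∀ (t : List ℕ) (a : ℕ), (a :: t).IsChain r → (∀ x ∈ a :: t, x ∈ V) →
    (∀ x ∈ a :: t, f x = c) → (a :: t).IsChain (mono r V f) := by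
  intro t
  induction t with
  | nil => intro a _ _ _; simp
  | cons b t ih =>
    intro a hc hV hf
    rw [List.isChain_cons_cons] at hc ⊢
    refine ⟨⟨hc.1, hV a (by simp), hV b (by simp), ?_⟩, ih b hc.2 ?_ ?_⟩
    · rw [hf a (by simp), hf b (by simp)]
    · intro x hx; exact hV x (List.mem_cons_of_mem _ hx)
    · intro x hx; exact hf x (List.mem_cons_of_mem _ hx)

theorem not_good {D : Dgraph} {k : ℕ} (h : D.dichi = k + 1) (f : ℕ → Fin k) :
    ¬ Good (fun a b => (a, b) ∈ D.arcs) D.verts f := by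
  intro hg
  have : D.dichi ≤ k := by
    apply Nat.sInf_le
    refine ⟨f, ?_⟩
    rintro p ⟨h2, hn, hV, hc, hl⟩ ⟨c, hcol⟩
    cases p with
    | nil => simp at h2
    | cons a t =>
      have hch := chain_mono (r := fun a b => (a, b) ∈ D.arcs) t a hc hV hcol
      have hlast : (a :: t).getLast? = some ((a :: t).getLast (by simp)) :=
        List.getLast?_eq_some_getLast (by simp)
      have hr := chain_reach t a _ hch hlast
      have harc := hl _ a hlast (by simp)
      have hmem : (a :: t).getLast (by simp) ∈ a :: t := List.getLast_mem _
      apply hg a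
      refine Relation.TransGen.tail' hr ⟨harc, hV _ hmem, hV a (by simp), ?_⟩
      rw [hcol _ hmem, hcol a (by simp)]
  omega

theorem arcsOf_sub {D : Dgraph} {p : List ℕ} {u v : ℕ} (h : D.IsDipath p u v) :
    Dgraph.arcsOf p ⊆ D.arcs := by
  obtain ⟨_, hh, _, _, hc⟩ := h
  cases p with
  | nil => simp at hh
  | cons a t =>
    rintro ⟨x, y⟩ hxy
    exact arcsOf_chain (r := fun a b => (a, b) ∈ D.arcs) t a hc x y hxy

theorem arcsOf_ne {D : Dgraph} {p : List ℕ} {u v : ℕ} (h : D.IsDipath p u v) (huv : u ≠ v) :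
    ∃ a, a ∈ Dgraph.arcsOf p := by
  obtain ⟨_, hh, hl, _, hc⟩ := h
  match p with
  | [] => simp at hh
  | [a] =>
    simp at hh hl
    exact absurd (hh.symm.trans hl) huv
  | a :: b :: t => exact ⟨(a, b), by simp [Dgraph.arcsOf]⟩

theorem paths_bound {D : Dgraph} {u v n : ℕ} (huv : u ≠ v) (P : Fin n → List ℕ)
    (hP : ∀ i, D.IsDipath (P i) u v)
    (hd : Pairwise fun i j => Disjoint (Dgraph.arcsOf (P i)) (Dgraph.arcsOf (P j))) :
    n ≤ D.arcs.card := by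
  choose e he using fun i => arcsOf_ne (hP i) huv
  have : (Finset.univ : Finset (Fin n)).card ≤ D.arcs.card := by
    apply Finset.card_le_card_of_injOn e
    · intro i _
      exact arcsOf_sub (hP i) (he i)
    · intro i _ j _ hij
      by_contra hne
      exact Finset.disjoint_left.1 (hd hne) (he i) (hij ▸ he j)
  simpa using this

theorem small_cut {D : Dgraph} (hWF : D.WF) {k : ℕ} (h : D.lam = k) {u v : ℕ}
    (hu : u ∈ D.verts) (hv : v ∈ D.verts) (huv : u ≠ v) :
    ∃ X ⊆ D.verts, u ∈ X ∧ v ∉ X ∧ (D.dicutArcs X).card ≤ k := by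
  by_contra hcon
  push Not at hcon
  obtain ⟨P, hP, hd⟩ := menger D.verts D.arcs (fun a ha => ⟨(hWF a ha).1, (hWF a ha).2.1⟩)
    u v hu (k + 1) (by
      intro X hX huX hvX
      have := Nat.succ_le_of_lt (hcon X hX huX hvX)
      unfold Dgraph.dicutArcs at this
      convert this)
  have hP' : ∀ i, D.IsDipath (P i) u v := by
    intro i
    obtain ⟨h1, h2, h3, h4⟩ := hP i
    refine ⟨h1, h2, h3, ?_, h4⟩
    cases hp : P i with
    | nil => simp
    | cons a t =>
      rw [hp] at h2 h4
      simp at h2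
      subst h2
      have : ∀ (t : List ℕ) (a : ℕ), a ∈ D.verts → (a :: t).IsChain (fun x y => (x, y) ∈ D.arcs) →
          ∀ x ∈ a :: t, x ∈ D.verts := by
        intro t
        induction t with
        | nil => intro a ha _ x hx; simp at hx; rw [hx]; exact ha
        | cons b t ih =>
          intro a ha hc x hx
          rw [List.isChain_cons_cons] at hc
          rcases List.mem_cons.1 hx with rfl | hx
          · exact ha
          · exact ih b (hWF _ hc.1).2.1 hc.2 x hx
      exact this t a hu h4
  have h1 : k + 1 ≤ D.locLam u v := by
    apply le_csSup
    · refine ⟨D.arcs.card, ?_⟩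
      rintro n ⟨Q, hQ, hQd⟩
      exact paths_bound huv Q hQ hQd
    · exact ⟨P, hP', hd⟩
  have h2 : D.locLam u v ≤ D.lam := by
    apply le_csSup
    · refine ⟨D.arcs.card, ?_⟩
      rintro n ⟨a, ha, b, hb, hab, rfl⟩
      apply csSup_le'
      rintro n ⟨Q, hQ, hQd⟩
      exact paths_bound hab Q hQ hQd
    · exact ⟨u, hu, v, hv, huv, rfl⟩
  omega

theorem merge {k : ℕ} {A : Finset (ℕ × ℕ)} {X Y : Finset ℕ} {f g : ℕ → Fin k}
    (hXY : Disjoint X Y) (hf : Good (fun a b => (a, b) ∈ A) X f)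
    (hg : Good (fun a b => (a, b) ∈ A) Y g)
    (hc : (A.filter fun a => a.1 ∈ X ∧ a.2 ∈ Y).card < k) :
    ∃ h : ℕ → Fin k, Good (fun a b => (a, b) ∈ A) (X ∪ Y) h := by
  have : NeZero k := ⟨by omega⟩
  have : ∃ s : Fin k, s ∉ (A.filter fun a => a.1 ∈ X ∧ a.2 ∈ Y).image (fun a => f a.1 - g a.2) := by
    by_contra hcon
    push Not at hcon
    have h1 : (Finset.univ : Finset (Fin k)) ⊆
      (A.filter fun a => a.1 ∈ X ∧ a.2 ∈ Y).image (fun a => f a.1 - g a.2) := fun s _ => hcon s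
    have h2 := Finset.card_le_card h1
    have h3 := Finset.card_image_le (s := A.filter fun a => a.1 ∈ X ∧ a.2 ∈ Y)
      (f := fun a => f a.1 - g a.2)
    simp only [Finset.card_univ, Fintype.card_fin] at h2
    omega
  obtain ⟨s, hs⟩ := this
  set h : ℕ → Fin k := fun v => if v ∈ X then f v else g v + s with hh
  have hX : ∀ v ∈ X, h v = f v := fun v hv => by simp [hh, hv]
  have hY : ∀ v ∈ Y, h v = g v + s := fun v hv => by
    simp [hh, Finset.disjoint_right.1 hXY hv]
  have hno : ∀ a b, mono (fun a b => (a, b) ∈ A) (X ∪ Y) h a b → a ∈ X → b ∈ X := by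
    rintro a b ⟨h1, _, h3, h4⟩ ha
    by_contra hb
    have hbY : b ∈ Y := (Finset.mem_union.1 h3).resolve_left hb
    apply hs
    refine Finset.mem_image.2 ⟨(a, b), Finset.mem_filter.2 ⟨h1, ha, hbY⟩, ?_⟩
    rw [hX a ha, hY b hbY] at h4
    simp [h4]
  have kX : ∀ a b, Relation.TransGen (mono (fun a b => (a, b) ∈ A) (X ∪ Y) h) a b → a ∈ X →
      b ∈ X ∧ Relation.TransGen (mono (fun a b => (a, b) ∈ A) X f) a b := by
    intro a b hab ha
    have one : ∀ a b, mono (fun a b => (a, b) ∈ A) (X ∪ Y) h a b → a ∈ X →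
        mono (fun a b => (a, b) ∈ A) X f a b := by
      intro a b hab ha
      have hb := hno a b hab ha
      refine ⟨hab.1, ha, hb, ?_⟩
      rw [← hX a ha, ← hX b hb]; exact hab.2.2.2
    induction hab with
    | single hab => exact ⟨hno _ _ hab ha, Relation.TransGen.single (one _ _ hab ha)⟩
    | tail _ hbc ih => exact ⟨hno _ _ hbc ih.1, ih.2.tail (one _ _ hbc ih.1)⟩
  have kY : ∀ a b, Relation.TransGen (mono (fun a b => (a, b) ∈ A) (X ∪ Y) h) a b → b ∉ X →
      a ∉ X ∧ Relation.TransGen (mono (fun a b => (a, b) ∈ A) Y g) a b := by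
    intro a b hab hb
    have one : ∀ a b, mono (fun a b => (a, b) ∈ A) (X ∪ Y) h a b → b ∉ X →
        mono (fun a b => (a, b) ∈ A) Y g a b := by
      intro a b hab hb
      have ha := fun ha => hb (hno a b hab ha)
      have ha' := (Finset.mem_union.1 hab.2.1).resolve_left ha
      have hb' := (Finset.mem_union.1 hab.2.2.1).resolve_left hb
      refine ⟨hab.1, ha', hb', ?_⟩
      have := hab.2.2.2
      rw [hY a ha', hY b hb'] at this
      exact add_right_cancel this
    induction hab using Relation.TransGen.head_induction_on with
    | single hab => exact ⟨fun ha => hb (hno _ _ hab ha), Relation.TransGen.single (one _ _ hab hb)⟩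
    | head hac _ ih =>
      exact ⟨fun ha => ih.1 (hno _ _ hac ha), Relation.TransGen.head (one _ _ hac ih.1) ih.2⟩
  refine ⟨h, fun a ha => ?_⟩
  by_cases haX : a ∈ X
  · exact hf a (kX a a ha haX).2
  · exact hg a (kY a a ha haX).2

theorem exit_rel {R : ℕ → ℕ → Prop} {a b : ℕ} {Q : Finset ℕ} (h : Relation.ReflTransGen R a b)
    (ha : a ∈ Q) (hb : b ∉ Q) : ∃ p ∈ Q, ∃ s, s ∉ Q ∧ R p s := by
  induction h with
  | refl => exact absurd ha hb
  | @tail c d _ hcd ih =>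
    by_cases hc : c ∈ Q
    · exact ⟨c, hc, d, hb, hcd⟩
    · exact ih hc

theorem strong_reach {D : Dgraph} (hs : D.Strong) {u v : ℕ} (hu : u ∈ D.verts)
    (hv : v ∈ D.verts) : Relation.ReflTransGen (fun a b => (a, b) ∈ D.arcs) u v := by
  by_cases huv : u = v
  · rw [huv]
  obtain ⟨p, _, hh, hl, _, hc⟩ := hs u hu v hv huv
  cases p with
  | nil => simp at hh
  | cons a t =>
    simp only [List.head?_cons, Option.some.injEq] at hh
    subst hh
    exact chain_reach t a v hc hl

/-- The whole digraph is critical. -/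
theorem whole {D : Dgraph} (hWF : D.WF) (hb : D.Biconnected) (hs : D.Strong) {k : ℕ}
    (hM : ∀ u ∈ D.verts, ∀ v ∈ D.verts, u ≠ v →
      ∃ X ⊆ D.verts, u ∈ X ∧ v ∉ X ∧ (D.dicutArcs X).card ≤ k)
    {W : Finset ℕ} (hW : W ⊆ D.verts) (h2 : 1 < W.card)
    (hcut : ∀ X ⊆ W, X.Nonempty → X ≠ W →
      k ≤ (D.arcs.filter fun a => a.1 ∈ X ∧ a.2 ∈ W \ X).card) : W = D.verts := by
  by_contra hne
  obtain ⟨z0, hz0, hz0W⟩ := Finset.exists_of_ssubset (hW.ssubset_of_ne hne)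
  set R : ℕ → ℕ → Prop := fun a b => (a, b) ∈ D.arcs ∧ ¬ (a ∈ W ∧ b ∈ W) with hR
  have key : ∀ u ∈ W, ∀ v ∈ W, Relation.ReflTransGen R u v → u = v := by
    intro u hu v hv huv
    by_contra hne
    obtain ⟨X, hX, huX, hvX, hXk⟩ := hM u (hW hu) v (hW hv) hne
    have h1 := hcut (X ∩ W) Finset.inter_subset_right ⟨u, Finset.mem_inter.2 ⟨huX, hu⟩⟩
      (fun h => hvX (Finset.mem_inter.1 (h.symm.subset hv)).1)
    have hsub : (D.arcs.filter fun a => a.1 ∈ X ∩ W ∧ a.2 ∈ W \ (X ∩ W)) ⊆ D.dicutArcs X := by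
      intro a ha
      simp only [Finset.mem_filter, Finset.mem_inter, Finset.mem_sdiff, Dgraph.dicutArcs] at ha ⊢
      tauto
    have heq := Finset.eq_of_subset_of_card_le hsub (hXk.trans h1)
    obtain ⟨p, hp, s, hsX, hps⟩ := exit_rel huv huX hvX
    have : (p, s) ∈ D.dicutArcs X := Finset.mem_filter.2 ⟨hps.1, hp, hsX⟩
    rw [← heq] at this
    simp only [Finset.mem_filter, Finset.mem_inter, Finset.mem_sdiff] at this
    exact hps.2 ⟨this.2.1.2, this.2.2.1⟩
  have hWne : W.Nonempty := Finset.card_pos.1 (by omega)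
  obtain ⟨a0, ha0⟩ := hWne
  have from_W : ∀ z ∈ D.verts, ∃ w ∈ W, Relation.ReflTransGen R w z := by
    intro z hz
    have h := strong_reach hs (hW ha0) hz
    clear hz
    induction h with
    | refl => exact ⟨a0, ha0, Relation.ReflTransGen.refl⟩
    | @tail b c _ hbc ih =>
      by_cases hc : c ∈ W
      · exact ⟨c, hc, Relation.ReflTransGen.refl⟩
      · obtain ⟨w, hw, h⟩ := ih
        exact ⟨w, hw, h.tail ⟨hbc, fun h => hc h.2⟩⟩
  have to_W : ∀ z ∈ D.verts, ∃ w ∈ W, Relation.ReflTransGen R z w := by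
    intro z hz
    have h := strong_reach hs hz (hW ha0)
    clear hz
    induction h using Relation.ReflTransGen.head_induction_on with
    | refl => exact ⟨a0, ha0, Relation.ReflTransGen.refl⟩
    | @head b c hbc _ ih =>
      by_cases hb : b ∈ W
      · exact ⟨b, hb, Relation.ReflTransGen.refl⟩
      · obtain ⟨w, hw, h⟩ := ih
        exact ⟨w, hw, Relation.ReflTransGen.head ⟨hbc, fun h => hb h.1⟩ h⟩
  have both : ∀ z ∈ D.verts, ∃ w ∈ W, Relation.ReflTransGen R w z ∧ Relation.ReflTransGen R z w := by
    intro z hz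
    obtain ⟨w, hw, h⟩ := from_W z hz
    obtain ⟨w', hw', h'⟩ := to_W z hz
    have := key w hw w' hw' (h.trans h')
    exact ⟨w, hw, h, this ▸ h'⟩
  obtain ⟨w0, hw0, hwz, hzw⟩ := both z0 hz0
  obtain ⟨w1, hw1, hw10⟩ := Finset.exists_mem_ne h2 w0
  refine hb.2 w0 ⟨hW hw0, fun hcon => ?_⟩
  have hmem : ∀ x ∈ D.verts, x ≠ w0 → x ∈ (D.delVert w0).verts := by
    intro x hx hxw
    simp [Dgraph.delVert, Dgraph.induce, hx, hxw]
  have hreach := hcon.2 z0 (hmem z0 hz0 (fun h => hz0W (h ▸ hw0))) w1 (hmem w1 (hW hw1) hw10)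
  have inv : w1 ∉ W ∧ Relation.ReflTransGen R w0 w1 ∧ Relation.ReflTransGen R w1 w0 := by
    unfold Dgraph.UReach at hreach
    clear hw1 hw10
    induction hreach with
    | refl => exact ⟨hz0W, hwz, hzw⟩
    | @tail z y _ hzy ih =>
      obtain ⟨i1, i2, i3⟩ := ih
      have harc : ∀ p q, (p, q) ∈ (D.delVert w0).arcs → (p, q) ∈ D.arcs ∧ p ≠ w0 ∧ q ≠ w0 := by
        intro p q h
        simp only [Dgraph.delVert, Dgraph.induce, Finset.mem_filter, Finset.mem_erase] at h
        tauto
      rcases hzy with h | h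
      · obtain ⟨h1, _, h3⟩ := harc _ _ h
        have hRzy : R z y := ⟨h1, fun h => i1 h.1⟩
        have hyW : y ∉ W := fun hy => h3 (key w0 hw0 y hy (i2.tail hRzy)).symm
        obtain ⟨w, hw, j1, j2⟩ := both y (hWF _ h1).2.1
        have := key w0 hw0 w hw ((i2.tail hRzy).trans j2)
        subst this
        exact ⟨hyW, j1, j2⟩
      · obtain ⟨h1, h3, _⟩ := harc _ _ h
        have hRyz : R y z := ⟨h1, fun h => i1 h.2⟩
        have hyW : y ∉ W := fun hy => h3 (key y hy w0 hw0 (Relation.ReflTransGen.head hRyz i3))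
        obtain ⟨w, hw, j1, j2⟩ := both y (hWF _ h1).1
        have := key w hw w0 hw0 (j1.trans (Relation.ReflTransGen.head hRyz i3))
        subst this
        exact ⟨hyW, j1, j2⟩
  exact inv.1 hw1

theorem critical {D : Dgraph} (hWF : D.WF) (hb : D.Biconnected) (hs : D.Strong) {k : ℕ} (hk : 0 < k)
    (hnc : ∀ f : ℕ → Fin k, ¬ Good (fun a b => (a, b) ∈ D.arcs) D.verts f)
    (hM : ∀ u ∈ D.verts, ∀ v ∈ D.verts, u ≠ v →
      ∃ X ⊆ D.verts, u ∈ X ∧ v ∉ X ∧ (D.dicutArcs X).card ≤ k) :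
    1 < D.verts.card ∧
    (∀ v ∈ D.verts, ∃ f : ℕ → Fin k, Good (fun a b => (a, b) ∈ D.arcs) (D.verts.erase v) f) ∧
    (∀ X, D.IsDicutSide X → k ≤ (D.dicutArcs X).card) := by
  obtain ⟨W, ⟨hWV, hWnc⟩, hmin⟩ := (wellFounded_lt (α := Finset ℕ)).has_min
    {W | W ⊆ D.verts ∧ ∀ f : ℕ → Fin k, ¬ Good (fun a b => (a, b) ∈ D.arcs) W f}
    ⟨D.verts, subset_rfl, hnc⟩
  have hmin' : ∀ S, S ⊆ W → S ≠ W → ∃ f : ℕ → Fin k, Good (fun a b => (a, b) ∈ D.arcs) S f := by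
    intro S hS hne
    by_contra hcon
    push Not at hcon
    exact hmin S ⟨hS.trans hWV, hcon⟩ (hS.ssubset_of_ne hne)
  have h2 : 1 < W.card := by
    by_contra hle
    push Not at hle
    apply hWnc (fun _ => ⟨0, hk⟩)
    intro a ha
    obtain ⟨b, hab, _⟩ := Relation.TransGen.head'_iff.1 ha
    have : a = b := Finset.card_le_one.1 hle a hab.2.1 b hab.2.2.1
    exact (hWF _ hab.1).2.2 this
  have hcut : ∀ X ⊆ W, X.Nonempty → X ≠ W →
      k ≤ (D.arcs.filter fun a => a.1 ∈ X ∧ a.2 ∈ W \ X).card := by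
    intro X hX hXne hXW
    by_contra hlt
    push Not at hlt
    obtain ⟨f, hf⟩ := hmin' X hX hXW
    obtain ⟨g, hg⟩ := hmin' (W \ X) Finset.sdiff_subset (by
      intro h
      obtain ⟨x, hx⟩ := hXne
      have : x ∈ W \ X := h.symm.subset (hX hx)
      exact (Finset.mem_sdiff.1 this).2 hx)
    obtain ⟨h, hh⟩ := merge Finset.disjoint_sdiff hf hg hlt
    rw [Finset.union_sdiff_of_subset hX] at hh
    exact hWnc h hh
  have hWV' := whole hWF hb hs hM hWV h2 hcut
  subst hWV'
  refine ⟨h2, ?_, ?_⟩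
  · intro v hv
    exact hmin' _ (Finset.erase_subset _ _) (fun h => by
      have := Finset.erase_eq_self.1 h
      exact this hv)
  · rintro X ⟨hX, hXne, hXV⟩
    refine (hcut X hX hXne hXV).trans (Finset.card_le_card ?_)
    intro a ha
    simp only [Finset.mem_filter, Finset.mem_sdiff, Dgraph.dicutArcs] at ha ⊢
    tauto

theorem cut_single {D : Dgraph} (hWF : D.WF) (u : ℕ) :
    (D.dicutArcs {u}).card = (Nout (fun a b => (a, b) ∈ D.arcs) D.verts u).card := by
  apply Finset.card_bij (fun a _ => a.2)
  · rintro ⟨a, b⟩ h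
    simp only [Dgraph.dicutArcs, Finset.mem_filter, Finset.mem_singleton] at h
    rw [mem_Nout]
    obtain ⟨h1, rfl, h3⟩ := h
    exact ⟨(hWF _ h1).2.1, h1⟩
  · rintro ⟨a, b⟩ h ⟨a', b'⟩ h' he
    simp only [Dgraph.dicutArcs, Finset.mem_filter, Finset.mem_singleton] at h h' he
    rw [h.2.1, h'.2.1, he]
  · intro b hb
    rw [mem_Nout] at hb
    refine ⟨(u, b), ?_, rfl⟩
    simp only [Dgraph.dicutArcs, Finset.mem_filter, Finset.mem_singleton]
    refine ⟨hb.2, trivial, fun h => (hWF _ hb.2).2.2 h.symm⟩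

theorem cut_cosingle {D : Dgraph} (hWF : D.WF) {X : Finset ℕ} (hX : X ⊆ D.verts) {v : ℕ}
    (h : D.verts \ X = {v}) :
    (D.dicutArcs X).card = (Nout (rev fun a b => (a, b) ∈ D.arcs) D.verts v).card := by
  have hm : ∀ y ∈ D.verts, y ∉ X ↔ y = v := by
    intro y hy
    rw [← Finset.mem_singleton, ← h, Finset.mem_sdiff]
    tauto
  have hv : v ∈ D.verts ∧ v ∉ X := by
    rw [← Finset.mem_sdiff, h]; simp
  apply Finset.card_bij (fun a _ => a.1)
  · rintro ⟨a, b⟩ h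
    simp only [Dgraph.dicutArcs, Finset.mem_filter] at h
    rw [mem_Nout]
    obtain ⟨h1, h2, h3⟩ := h
    have := (hm b (hWF _ h1).2.1).1 h3
    subst this
    exact ⟨(hWF _ h1).1, h1⟩
  · rintro ⟨a, b⟩ h ⟨a', b'⟩ h' he
    simp only [Dgraph.dicutArcs, Finset.mem_filter] at h h' he
    rw [(hm b (hWF _ h.1).2.1).1 h.2.2, (hm b' (hWF _ h'.1).2.1).1 h'.2.2, he]
  · intro b hb
    rw [mem_Nout] at hb
    have hb2 : (b, v) ∈ D.arcs := hb.2
    refine ⟨(b, v), ?_, rfl⟩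
    simp only [Dgraph.dicutArcs, Finset.mem_filter]
    refine ⟨hb2, ?_, hv.2⟩
    by_contra hbX
    exact (hWF _ hb2).2.2 ((hm b hb.1).1 hbX)

theorem all_eq_of_sum {V : Finset ℕ} {g : ℕ → ℕ} {k : ℕ} (h : ∀ v ∈ V, k ≤ g v)
    (hs : ∑ v ∈ V, g v = ∑ _v ∈ V, k) : ∀ v ∈ V, g v = k := by
  intro v hv
  exact (((Finset.sum_eq_sum_iff_of_le h).1 hs.symm) v hv).symm

theorem find_x {V : Finset ℕ} {r : ℕ → ℕ → Prop} {k : ℕ} (hV : V.Nonempty)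
    (ho : ∀ v ∈ V, k ≤ (Nout r V v).card) (hi : ∀ v ∈ V, k ≤ (Nout (rev r) V v).card)
    (hor : ∀ u ∈ V, ∀ v ∈ V, u ≠ v → (Nout r V u).card ≤ k ∨ (Nout (rev r) V v).card ≤ k) :
    ∃ x ∈ V, ∀ v ∈ V, v ≠ x → Reg k r V v := by
  have hsum := sum_Nout r V
  by_cases hall : ∀ v ∈ V, (Nout r V v).card = k
  · obtain ⟨x, hx⟩ := hV
    rw [Finset.sum_congr rfl hall] at hsum
    exact ⟨x, hx, fun v hv _ => ⟨hv, hall v hv, all_eq_of_sum hi hsum.symm v hv⟩⟩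
  · push Not at hall
    obtain ⟨u, hu, hne⟩ := hall
    have hin : ∀ v ∈ V, v ≠ u → (Nout (rev r) V v).card = k := by
      intro v hv hvu
      have := hor u hu v hv hvu.symm
      have := hi v hv
      have := ho u hu
      omega
    refine ⟨u, hu, fun v hv hvu => ⟨hv, ?_, hin v hv hvu⟩⟩
    by_contra hnv
    have hinu : (Nout (rev r) V u).card = k := by
      have := hor v hv u hu hvu
      have := hi u hu
      have := ho v hv
      omega
    have hin' : ∀ v ∈ V, (Nout (rev r) V v).card = k := by
      intro w hw
      by_cases h : w = u
      · rw [h]; exact hinu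
      · exact hin w hw h
    rw [Finset.sum_congr rfl hin'] at hsum
    exact hne (all_eq_of_sum ho hsum u hu)

theorem main (k : ℕ) (hk : 4 ≤ k) (D : Dgraph) (hWF : D.WF)
    (hext : Dgraph.Extremal k D)
    (hiso : ∀ X, D.IsMinDicut X → (∃ x, X = {x}) ∨ (∃ x, D.verts \ X = {x})) :
    Dgraph.IsBiComplete D (k + 1) := by
  obtain ⟨hb, hs, hchi, hlam⟩ := hext
  have hM : ∀ u ∈ D.verts, ∀ v ∈ D.verts, u ≠ v →
      ∃ X ⊆ D.verts, u ∈ X ∧ v ∉ X ∧ (D.dicutArcs X).card ≤ k :=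
    fun u hu v hv huv => small_cut hWF hlam hu hv huv
  obtain ⟨h2, crit, hcut⟩ := critical hWF hb hs (by omega) (not_good hchi) hM
  have C : Ctx k D.verts (fun a b => (a, b) ∈ D.arcs) :=
    ⟨fun a h => (hWF _ h).2.2 rfl, not_good hchi⟩
  have hout : ∀ v ∈ D.verts, k ≤ (Nout (fun a b => (a, b) ∈ D.arcs) D.verts v).card := by
    intro v hv
    rw [← cut_single hWF]
    refine hcut _ ⟨by simpa using hv, by simp, ?_⟩
    intro h
    rw [← h] at h2
    simp at h2
  have hin : ∀ v ∈ D.verts, k ≤ (Nout (rev fun a b => (a, b) ∈ D.arcs) D.verts v).card := by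
    intro v hv
    rw [← cut_cosingle hWF (X := D.verts.erase v) (Finset.erase_subset _ _)
      (Finset.sdiff_erase_self hv)]
    refine hcut _ ⟨Finset.erase_subset _ _, ?_, ?_⟩
    · apply Finset.card_pos.1
      rw [Finset.card_erase_of_mem hv]
      omega
    · intro h
      exact Finset.erase_eq_self.1 h hv
  have hmin : ∀ X, D.IsDicutSide X → (D.dicutArcs X).card ≤ k → D.IsMinDicut X :=
    fun X hX h => ⟨hX, fun Y hY => h.trans (hcut Y hY)⟩
  have hor : ∀ u ∈ D.verts, ∀ v ∈ D.verts, u ≠ v →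
      (Nout (fun a b => (a, b) ∈ D.arcs) D.verts u).card ≤ k ∨
      (Nout (rev fun a b => (a, b) ∈ D.arcs) D.verts v).card ≤ k := by
    intro u hu v hv huv
    obtain ⟨X, hX, huX, hvX, hc⟩ := hM u hu v hv huv
    rcases hiso X (hmin X ⟨hX, ⟨u, huX⟩, fun h => hvX (h ▸ hv)⟩ hc) with ⟨x, rfl⟩ | ⟨x, hx⟩
    · left
      rw [← cut_single hWF, Finset.mem_singleton.1 huX]
      exact hc
    · right
      have : v = x := by
        rw [← Finset.mem_singleton, ← hx]
        exact Finset.mem_sdiff.2 ⟨hv, hvX⟩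
      subst this
      rw [← cut_cosingle hWF hX hx]
      exact hc
  have hVne : D.verts.Nonempty := Finset.card_pos.1 (by omega)
  obtain ⟨x, hx, hreg⟩ := find_x hVne hout hin hor
  have hV3 : 3 ≤ D.verts.card := by
    have h1 := hout x hx
    have h3 : (Nout (fun a b => (a, b) ∈ D.arcs) D.verts x).card ≤ D.verts.card :=
      Finset.card_le_card (fun y hy => (mem_Nout.1 hy).1)
    omega
  obtain ⟨B, hBV, hBk, hBc⟩ := core hk C crit hx hreg hV3
  have hBV' : B ⊆ D.verts := hBV.trans (Finset.erase_subset _ _)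
  have hxB : x ∉ B := fun h => (Finset.mem_erase.1 (hBV h)).1 rfl
  have hregB : ∀ b ∈ B, Reg k (fun a b => (a, b) ∈ D.arcs) D.verts b := fun b hb =>
    hreg b (hBV' hb) (Finset.mem_erase.1 (hBV hb)).1
  have hBcut : (D.dicutArcs B).card ≤ k := by
    rw [← hBk]
    apply Finset.card_le_card_of_injOn Prod.fst
    · intro a ha
      exact (Finset.mem_filter.1 ha).2.1
    · rintro ⟨a, c⟩ h ⟨a', c'⟩ h' he
      have h := Finset.mem_filter.1 (Finset.mem_coe.1 h)
      have h' := Finset.mem_filter.1 (Finset.mem_coe.1 h')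
      simp only at he h h'
      subst he
      by_contra hne
      have hcc : c ≠ c' := fun e => hne (by rw [e])
      have hsub : insert c (insert c' (B.erase a)) ⊆
          Nout (fun a b => (a, b) ∈ D.arcs) D.verts a := by
        intro y hy
        rw [Finset.mem_insert, Finset.mem_insert] at hy
        rcases hy with rfl | rfl | hy
        · exact mem_Nout.2 ⟨(hWF _ h.1).2.1, h.1⟩
        · exact mem_Nout.2 ⟨(hWF _ h'.1).2.1, h'.1⟩
        · rw [← hBc a h.2.1] at hy
          exact Nout_sub hBV' hy
      have hle := Finset.card_le_card hsub
      rw [(hregB a h.2.1).2.1, Finset.card_insert_of_notMem, Finset.card_insert_of_notMem,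
        Finset.card_erase_of_mem h.2.1] at hle
      · omega
      · exact fun e => h'.2.2 (Finset.mem_of_mem_erase e)
      · rw [Finset.mem_insert]
        rintro (e | e)
        · exact hcc e
        · exact h.2.2 (Finset.mem_of_mem_erase e)
  have hBne : B.Nonempty := Finset.card_pos.1 (by omega)
  have hVB : D.verts \ B = {x} := by
    rcases hiso B (hmin B ⟨hBV', hBne, fun h => hxB (h ▸ hx)⟩ hBcut) with ⟨y, hy⟩ | ⟨y, hy⟩
    · rw [hy] at hBk
      simp at hBk
      omega
    · have : x ∈ D.verts \ B := Finset.mem_sdiff.2 ⟨hx, hxB⟩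
      rw [hy, Finset.mem_singleton] at this
      rw [hy, this]
  have hcard : D.verts.card = k + 1 := by
    have := Finset.card_sdiff_add_card_eq_card hBV'
    rw [hVB, Finset.card_singleton] at this
    omega
  have full : ∀ b ∈ B, Nout (fun a b => (a, b) ∈ D.arcs) D.verts b = D.verts.erase b ∧
      Nout (rev fun a b => (a, b) ∈ D.arcs) D.verts b = D.verts.erase b := by
    intro b hb
    have hR := hregB b hb
    constructor
    · apply Finset.eq_of_subset_of_card_le (Nout_sub_erase C.irr)
      rw [Finset.card_erase_of_mem hR.1, hR.2.1]
      omega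
    · apply Finset.eq_of_subset_of_card_le (Nout_sub_erase C.rev.irr)
      rw [Finset.card_erase_of_mem hR.1, hR.2.2]
      omega
  refine ⟨hcard, ?_⟩
  ext ⟨a, c⟩
  simp only [Finset.mem_filter, Finset.mem_product]
  constructor
  · intro h
    have := hWF _ h
    exact ⟨⟨this.1, this.2.1⟩, this.2.2⟩
  · rintro ⟨⟨ha, hc⟩, hac⟩
    by_cases haB : a ∈ B
    · have : c ∈ D.verts.erase a := Finset.mem_erase.2 ⟨hac.symm, hc⟩
      rw [← (full a haB).1] at this
      exact (mem_Nout.1 this).2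
    · have hax : a = x := by
        rw [← Finset.mem_singleton, ← hVB]
        exact Finset.mem_sdiff.2 ⟨ha, haB⟩
      have hcB : c ∈ B := by
        by_contra hcB
        have hcx : c = x := by
          rw [← Finset.mem_singleton, ← hVB]
          exact Finset.mem_sdiff.2 ⟨hc, hcB⟩
        exact hac (hax.trans hcx.symm)
      have : a ∈ D.verts.erase c := Finset.mem_erase.2 ⟨hac, ha⟩
      rw [← (full c hcB).2] at this
      exact (mem_Nout.1 this).2

end DgAux

/-- Lemma 4.5: for k ≥ 4, if every minimum dicut of a
k-extremal digraph isolates a vertex, then D = ↔K_{k+1}. -/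
theorem statement_7 (k : ℕ) (hk : 4 ≤ k) (D : Dgraph) (hWF : D.WF)
    (hext : Extremal k D)
    (hiso : ∀ X, D.IsMinDicut X → (∃ x, X = {x}) ∨ (∃ x, D.verts \ X = {x})) :
    IsBiComplete D (k + 1) := by
  exact DgAux.main k hk D hWF hext hiso
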